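/- Let X ⊂ ℙ^r be the Segre embedding of ℙ^{n_1} × ⋯ × ℙ^{n_q} over an algebraically closed field of characteristic 0, with n = Σ n_i = dim X and r = −1 + ∏(n_i+1). Let k be a positive integer and assume dim σ_{k+n−1}(X) = (k+n−1)(n+1)−1 < r (in particular X is not (k+n−1)-defective). Then X is j-identifiable for every j ≤ k. -/

import Mathlib

noncomputable section

namespace ContactLoci

variable {K : Type*} [Field K] {ι : Type*} [Fintype ι]

/-- Projective space over `K` with homogeneous coordinates indexed by `ι`. -/
abbrev PP (K : Type*) [Field K] (ι : Type*) : Type _ :=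
  Projectivization K (ι → K)

/-- The affine cone over a set of projective points. -/
def coneOf (S : Set (PP K ι)) : Set (ι → K) :=
  ⋃ x ∈ S, (x.submodule : Set (ι → K))

/-- The linear span, in the underlying vector space, of the cone over `S`. -/
def vspan (S : Set (PP K ι)) : Submodule K (ι → K) :=
  Submodule.span K (coneOf S)

/-- The projective linear span of a set of projective points. -/
def projSpan (S : Set (PP K ι)) : Set (PP K ι) :=
  {x | x.submodule ≤ vspan S}

/-- The projective dimension of the linear span of `S` (`-1` for `S = ∅`). -/
def projDim (S : Set (PP K ι)) : ℤ :=
  (Module.finrank K (vspan S) : ℤ) - 1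

/-- A set of projective points is non-degenerate if its linear span is everything. -/
def Nondegenerate (S : Set (PP K ι)) : Prop :=
  vspan S = ⊤

/-- The common zero locus in projective space of a set of polynomials. -/
def zeroLocus (S : Set (MvPolynomial ι K)) : Set (PP K ι) :=
  {x | ∀ f ∈ S, ∀ v ∈ x.submodule, MvPolynomial.eval v f = 0}

/-- Zariski-closed subsets of projective space: common zero loci of sets of
homogeneous polynomials. -/
def IsZClosed (X : Set (PP K ι)) : Prop :=
  ∃ S : Set (MvPolynomial ι K), (∀ f ∈ S, ∃ d : ℕ, f.IsHomogeneous d) ∧ X = zeroLocus S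

/-- Zariski closure. -/
def zclosure (S : Set (PP K ι)) : Set (PP K ι) :=
  ⋂₀ {Y | IsZClosed Y ∧ S ⊆ Y}

/-- Irreducibility with respect to the Zariski topology. -/
def IsZIrreducible (S : Set (PP K ι)) : Prop :=
  S.Nonempty ∧ ∀ Y Z : Set (PP K ι), IsZClosed Y → IsZClosed Z → S ⊆ Y ∪ Z → S ⊆ Y ∨ S ⊆ Z

/-- An integral projective variety: a Zariski-closed irreducible subset. -/
def IsIntegralVariety (X : Set (PP K ι)) : Prop :=
  IsZClosed X ∧ IsZIrreducible X

/-- `C` is an irreducible component of `S`: a maximal irreducible subset of `S`. -/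
def IsZIrredComponent (S C : Set (PP K ι)) : Prop :=
  IsZIrreducible C ∧ C ⊆ S ∧ ∀ D : Set (PP K ι), IsZIrreducible D → D ⊆ S → C ⊆ D → C = D

/-- The dimension of a set: the Krull dimension of the poset of irreducible
Zariski-closed subsets of its Zariski closure (`⊥` for the empty set). -/
def zdim (S : Set (PP K ι)) : WithBot ℕ∞ :=
  Order.krullDim ({Y : Set (PP K ι) // IsZClosed Y ∧ IsZIrreducible Y ∧ Y ⊆ zclosure S})

/-- A property holds at a general point of `X`: it holds away from a proper
Zariski-closed subset. -/
def HoldsGenerically (X : Set (PP K ι)) (P : PP K ι → Prop) : Prop :=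
  ∃ Y : Set (PP K ι), IsZClosed Y ∧ ¬X ⊆ Y ∧ ∀ x ∈ X \ Y, P x

/-- Zero locus of multihomogeneous polynomials in a self-product of projective space. -/
def multiZeroLocus {m : ℕ} (S : Set (MvPolynomial (Fin m × ι) K)) :
    Set (Fin m → PP K ι) :=
  {u | ∀ f ∈ S, ∀ v : Fin m → ι → K, (∀ i, v i ∈ (u i).submodule) →
    MvPolynomial.eval (fun p => v p.1 p.2) f = 0}

/-- Zariski-closed subsets of the `m`-fold self-product of projective space. -/
def IsMultiZClosed {m : ℕ} (T : Set (Fin m → PP K ι)) : Prop :=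
  ∃ S : Set (MvPolynomial (Fin m × ι) K),
    (∀ f ∈ S, ∀ i : Fin m, ∃ d : ℕ,
      MvPolynomial.IsWeightedHomogeneous (fun p : Fin m × ι => if p.1 = i then 1 else 0) f d) ∧
    T = multiZeroLocus S

/-- A property holds for a general `m`-tuple of points of `X`. -/
def HoldsForGeneralTuples (X : Set (PP K ι)) (m : ℕ) (P : (Fin m → PP K ι) → Prop) : Prop :=
  ∃ T : Set (Fin m → PP K ι), IsMultiZClosed T ∧
    (∃ u : Fin m → PP K ι, (∀ i, u i ∈ X) ∧ u ∉ T) ∧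
    ∀ u : Fin m → PP K ι, (∀ i, u i ∈ X) → u ∉ T → P u

/-- The homogeneous vanishing ideal of `X` (as a set of homogeneous polynomials). -/
def homogVanishingIdeal (X : Set (PP K ι)) : Set (MvPolynomial ι K) :=
  {f | (∃ d : ℕ, f.IsHomogeneous d) ∧ ∀ x ∈ X, ∀ v ∈ x.submodule, MvPolynomial.eval v f = 0}

/-- The embedded (projective) tangent space of `X` at `x`. -/
def embTangentSpace (X : Set (PP K ι)) (x : PP K ι) : Set (PP K ι) :=
  {y | ∀ f ∈ homogVanishingIdeal X,
    ∑ i : ι, y.rep i * MvPolynomial.eval x.rep (MvPolynomial.pderiv i f) = 0}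

/-- Smooth points of `X`. -/
def IsSmoothPoint (X : Set (PP K ι)) (x : PP K ι) : Prop :=
  x ∈ X ∧ zdim (embTangentSpace X x) = zdim X

/-- `M_A`: the linear span of the tangent spaces of `X` at the points of `A`. -/
def tangentSpan (X A : Set (PP K ι)) : Set (PP K ι) :=
  projSpan (⋃ a ∈ A, embTangentSpace X a)

/-- The locus of smooth points of `X` at which `M_A` is tangent to `X`. -/
def tangencyLocus (X A : Set (PP K ι)) : Set (PP K ι) :=
  {x | IsSmoothPoint X x ∧ embTangentSpace X x ⊆ tangentSpan X A}

/-- The tangential contact locus of `X` at `A`: the closure of the union of the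
irreducible components of the tangency locus meeting `A`. -/
def contactLocus (X A : Set (PP K ι)) : Set (PP K ι) :=
  zclosure (⋃ C ∈ {C : Set (PP K ι) |
    IsZIrredComponent (tangencyLocus X A) C ∧ (C ∩ A).Nonempty}, C)

/-- `X` is weakly `k`-defective: the tangential contact locus at `k` general points
has positive dimension. -/
def WeaklyDefective (X : Set (PP K ι)) (k : ℕ) : Prop :=
  HoldsForGeneralTuples X k fun u => 0 < zdim (contactLocus X (Set.range u))

/-- The `k`-th secant variety of `X`. -/
def secant (k : ℕ) (X : Set (PP K ι)) : Set (PP K ι) :=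
  zclosure {q | ∃ S : Finset (PP K ι), ↑S ⊆ X ∧ S.card = k ∧ q ∈ projSpan (S : Set (PP K ι))}

/-- The `X`-rank of a point. -/
def xrank (X : Set (PP K ι)) (q : PP K ι) : ℕ :=
  sInf {k | ∃ S : Finset (PP K ι), ↑S ⊆ X ∧ S.card = k ∧ q ∈ projSpan (S : Set (PP K ι))}

/-- `𝒮(q,X)`: the set of minimal `X`-decompositions of `q`. -/
def decompositions (X : Set (PP K ι)) (q : PP K ι) : Set (Finset (PP K ι)) :=
  {S | ↑S ⊆ X ∧ S.card = xrank X q ∧ q ∈ projSpan (S : Set (PP K ι))}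

/-- `X` is `k`-identifiable: a general point of `σ_k(X)` has a unique minimal
decomposition. -/
def Identifiable (X : Set (PP K ι)) (k : ℕ) : Prop :=
  HoldsGenerically (secant k X) fun q => ∃! S : Finset (PP K ι), S ∈ decompositions X q

/-- `α` is the `k`-th secant degree of `X`. -/
def HasSecantDegree (X : Set (PP K ι)) (k α : ℕ) : Prop :=
  HoldsGenerically (secant k X) fun q => (decompositions X q).ncard = α

/-- Projective linear subspaces. -/
def IsProjLinear (L : Set (PP K ι)) : Prop :=
  L = projSpan L

/-- Lines in projective space. -/
def IsLine (L : Set (PP K ι)) : Prop :=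
  IsProjLinear L ∧ Module.finrank K (vspan L) = 2

/-- `X` is uniruled by lines: through a general point of `X` there is a line
contained in `X`. -/
def UniruledByLines (X : Set (PP K ι)) : Prop :=
  HoldsGenerically X fun x => ∃ L : Set (PP K ι), IsLine L ∧ x ∈ L ∧ L ⊆ X

/-- The join of two sets in projective space. -/
def join (A B : Set (PP K ι)) : Set (PP K ι) :=
  zclosure (⋃ a ∈ A, ⋃ b ∈ B, projSpan {a, b})

/-- The linear space `M` is tangent to `X` along `W`. -/
def TangentAlong (M X W : Set (PP K ι)) : Prop :=
  ∀ x ∈ W, IsSmoothPoint X x → embTangentSpace X x ⊆ M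

/-- `S` has exactly `m` irreducible components, all of them projective linear
subspaces, and these components are linearly independent. -/
def ComponentsAreIndepLinear (S : Set (PP K ι)) (m : ℕ) : Prop :=
  ∃ C : Fin m → Set (PP K ι), Function.Injective C ∧
    (∀ D : Set (PP K ι), IsZIrredComponent S D ↔ ∃ i, D = C i) ∧
    (∀ i, IsProjLinear (C i)) ∧
    Module.finrank K (vspan S) = ∑ i, Module.finrank K (vspan (C i))


/-- The Segre variety: the image of `ℙ^{n 1} × ⋯ × ℙ^{n s}` under the Segre
embedding, given by the complete linear system `|O(1,…,1)|`. -/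
def segreVariety (K : Type*) [Field K] (s : ℕ) (n : Fin s → ℕ) :
    Set (PP K (∀ i : Fin s, Fin (n i + 1))) :=
  {x | ∃ u : ∀ i : Fin s, Fin (n i + 1) → K,
    x.submodule = Submodule.span K
      ({fun t => ∏ i, u i (t i)} : Set ((∀ i : Fin s, Fin (n i + 1)) → K))}

/-- The projection of `L ⊆ Segre` to the `i`-th factor is a single point, i.e. `L`
lies in a single fiber of the `i`-th projection. -/
def SegreFactorIsPoint (K : Type*) [Field K] (s : ℕ) (n : Fin s → ℕ) (i : Fin s)
    (L : Set (PP K (∀ j : Fin s, Fin (n j + 1)))) : Prop :=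
  ∃ w : Fin (n i + 1) → K, w ≠ 0 ∧ ∀ x ∈ L,
    ∃ u : ∀ j : Fin s, Fin (n j + 1) → K,
      x.submodule = Submodule.span K
        ({fun t => ∏ j, u j (t j)} : Set ((∀ j : Fin s, Fin (n j + 1)) → K)) ∧
      u i ∈ Submodule.span K ({w} : Set (Fin (n i + 1) → K))

/-- Index type for the Segre–Veronese embedding of multidegree `d`:
multi-indices of degree `d i` in the homogeneous variables of the `i`-th factor. -/
abbrev svIndex (s : ℕ) (n d : Fin s → ℕ) : Type :=
  ∀ i : Fin s, {w : Fin (n i + 1) → Fin (d i + 1) // ∑ j, (w j : ℕ) = d i}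

/-- The Segre–Veronese variety of multidegree `d`: the image of
`ℙ^{n 1} × ⋯ × ℙ^{n s}` under the embedding by `|L_1^{d 1} ⊗ ⋯ ⊗ L_s^{d s}|`. -/
def segreVeroneseVariety (K : Type*) [Field K] (s : ℕ) (n d : Fin s → ℕ) :
    Set (PP K (svIndex s n d)) :=
  {x | ∃ u : ∀ i : Fin s, Fin (n i + 1) → K,
    x.submodule = Submodule.span K
      ({fun t => ∏ i, ∏ j, u i j ^ ((t i).1 j : ℕ)} : Set (svIndex s n d → K))}

/-- The vector of the moments of degree `≤ d` of the one-dimensional Gaussian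
distribution with mean `μ` and variance `t`. -/
def gaussMomentVec (K : Type*) [Field K] (d : ℕ) (μ t : K) : Fin (d + 1) → K := fun i =>
  ∑ j ∈ Finset.range ((i : ℕ) / 2 + 1),
    ((Nat.choose (i : ℕ) (2 * j) * Nat.doubleFactorial (2 * j - 1) : ℕ) : K) *
      t ^ j * μ ^ ((i : ℕ) - 2 * j)

/-- The Gaussian moment variety `𝒢_{1,d} ⊆ ℙ^d`. -/
def gaussianMomentVariety (K : Type*) [Field K] (d : ℕ) : Set (PP K (Fin (d + 1))) :=
  zclosure {x | ∃ μ t : K,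
    x.submodule = Submodule.span K ({gaussMomentVec K d μ t} : Set (Fin (d + 1) → K))}

/-- Zariski-closed families of `m`-tuples of coefficient vectors of linear forms. -/
def IsAffineClosedFamily {m : ℕ} (T : Set (Fin m → ι → K)) : Prop :=
  ∃ S : Set (MvPolynomial (Fin m × ι) K),
    T = {h | ∀ f ∈ S, MvPolynomial.eval (fun p => h p.1 p.2) f = 0}

/-- The linear subspace cut out by the `m` linear forms with coefficient vectors `h`. -/
def linearSlice {m : ℕ} (h : Fin m → ι → K) : Set (PP K ι) :=
  {x | ∀ j : Fin m, ∑ i : ι, h j i * x.rep i = 0}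

/-- `x` lies on the hyperplane with coefficient vector `f`. -/
def inHyperplane (f : ι → K) (x : PP K ι) : Prop :=
  ∑ i : ι, f i * x.rep i = 0

/-- `X ⊆ ℙ^r` (of dimension `n`, `r + 1 = card ι`) is very strange: for a general
codimension-`n` linear subspace `M`, some `r - n + 2` points of `X ∩ M` lie in a
hyperplane of `M`, i.e. in a linear subspace of projective dimension `r - n - 1`. -/
def VeryStrange (n : ℕ) (X : Set (PP K ι)) : Prop :=
  ∃ T : Set (Fin n → ι → K), IsAffineClosedFamily T ∧ (∃ h, h ∉ T) ∧
    ∀ h : Fin n → ι → K, h ∉ T →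
      ∃ A : Finset (PP K ι), ↑A ⊆ X ∩ linearSlice h ∧
        A.card = Fintype.card ι + 1 - n ∧
        Module.finrank K (vspan (A : Set (PP K ι))) ≤ Fintype.card ι - 1 - n


section deriv
variable {K : Type*} [Field K] [CharZero K] {A : Type*} [Field A] [Algebra K A]

lemma deriv_eq_zero_of_isAlgebraic (D : Derivation K A A) (B : Subalgebra K A)
    (hB : ∀ b ∈ B, D b = 0) (x : A) (hx : IsAlgebraic B x) : D x = 0 := by
  obtain ⟨p, hp0, hpx⟩ := hx
  let C : IntermediateField K A :=
    { carrier := {a | D a = 0}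
      mul_mem' := by intro a b ha hb; simp at *; simp [ha, hb]
      add_mem' := by intro a b ha hb; simp at *; simp [ha, hb]
      algebraMap_mem' := by intro r; simp
      inv_mem' := by intro a ha; simp at *; simp [ha, Derivation.leibniz_inv] }
  have hBC : B ≤ C.toSubalgebra := fun b hb => hB b hb
  let D' : Derivation C A A := Derivation.mk'
    { toFun := D, map_add' := D.map_add, map_smul' := by
        intro c a
        have hc : D (c : A) = 0 := c.2
        simp [Algebra.smul_def, hc] } (by intro a b; simp)
  have halg : IsAlgebraic C x := by
    refine ⟨p.map (Subalgebra.inclusion hBC).toRingHom, ?_, ?_⟩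
    · exact (Polynomial.map_ne_zero_iff (Subalgebra.inclusion_injective hBC)).2 hp0
    · have : (algebraMap C A).comp (Subalgebra.inclusion hBC).toRingHom = algebraMap B A := rfl
      rw [Polynomial.aeval_def, Polynomial.eval₂_map, this]; exact hpx
  have : CharZero C := charZero_of_injective_algebraMap (algebraMap K C).injective
  have hint : IsIntegral C x := halg.isIntegral
  have h1 := D'.map_aeval (minpoly C x) x
  rw [minpoly.aeval, map_zero] at h1
  have hsep : (minpoly C x).Separable := (minpoly.irreducible hint).separable
  have h2 : Polynomial.aeval x (minpoly C x).derivative ≠ 0 :=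
    hsep.aeval_derivative_ne_zero (minpoly.aeval C x)
  have h3 := (smul_eq_zero.1 h1.symm).resolve_left h2
  exact h3

lemma exists_deriv {I : Type*} {z : I → A} (hz : AlgebraicIndependent K z) (c : I → A) :
    ∃ D : Derivation K A A, ∀ i, D (z i) = c i := by
  obtain ⟨s, hs, hb⟩ := exists_isTranscendenceBasis_superset (AlgebraicIndependent.to_subtype_range hz)
  let R := MvPolynomial s K
  let _ : Algebra R A := (MvPolynomial.aeval (fun x : s => (x : A))).toAlgebra
  have hinj : Function.Injective (algebraMap R A) := hb.1
  have : IsScalarTower K R A := IsScalarTower.of_algebraMap_eq (fun x => by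
    rw [RingHom.algebraMap_toAlgebra]; simp [R, MvPolynomial.algebraMap_eq])
  have : FaithfulSMul R A := (faithfulSMul_iff_algebraMap_injective R A).2 hinj
  let F := FractionRing R
  let _ : Algebra F A := FractionRing.liftAlgebra R A
  have : IsScalarTower R F A := FractionRing.isScalarTower_liftAlgebra R A
  have : CharZero R := charZero_of_injective_algebraMap (algebraMap K R).injective
  have : CharZero F := charZero_of_injective_algebraMap (IsFractionRing.injective R F)
  have : Algebra.IsAlgebraic R A := by
    have := hb.isAlgebraic
    constructor
    intro x
    obtain ⟨p, hp0, hpx⟩ := this.isAlgebraic x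
    let e := hb.1.aevalEquiv
    have hr : Set.range (fun x : s => (x : A)) = Set.range (Subtype.val : s → A) := rfl
    refine ⟨p.map e.symm.toRingEquiv.toRingHom, ?_, ?_⟩
    · exact (Polynomial.map_ne_zero_iff e.symm.injective).2 hp0
    · rw [Polynomial.aeval_def, Polynomial.eval₂_map]
      rw [Polynomial.aeval_def] at hpx
      have hcomp : (algebraMap R A).comp e.symm.toRingEquiv.toRingHom =
          algebraMap (Algebra.adjoin K (Set.range (Subtype.val : s → A))) A := by
        refine RingHom.ext fun b => ?_
        obtain ⟨r, rfl⟩ := e.surjective b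
        have h1 : e.symm.toRingEquiv.toRingHom (e r) = r := e.symm_apply_apply r
        rw [RingHom.comp_apply, h1]
        exact (hb.1.algebraMap_aevalEquiv r).symm
      rw [hcomp]; exact hpx
  have : Algebra.IsAlgebraic F A := (IsFractionRing.comap_isAlgebraic_iff (A := R)).1 ‹_›
  have : Algebra.FormallyEtale F A := Algebra.FormallyEtale.of_isSeparable F A
  have : Algebra.FormallyEtale R F :=
    Algebra.FormallyEtale.of_isLocalization (nonZeroDivisors R)
  have : Algebra.FormallyEtale R A := Algebra.FormallyEtale.comp R F A
  classical
  let c' : s → A := fun x => if h : ∃ i, z i = x then c h.choose else 0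
  let D0 : Derivation K R A := MvPolynomial.mkDerivation K c'
  let e := KaehlerDifferential.tensorKaehlerEquivOfFormallyEtale K R A
  let f : Ω[A⁄K] →ₗ[A] A :=
    (LinearMap.liftBaseChange A D0.liftKaehlerDifferential).comp e.symm.toLinearMap
  refine ⟨f.compDer (KaehlerDifferential.D K A), fun i => ?_⟩
  have hi : z i ∈ s := hs ⟨i, rfl⟩
  have h1 : z i = algebraMap R A (MvPolynomial.X ⟨z i, hi⟩) := by
    rw [RingHom.algebraMap_toAlgebra]; simp [R]
  have h2 : c' ⟨z i, hi⟩ = c i := by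
    have hex : ∃ j, z j = z i := ⟨i, rfl⟩
    simp only [c', hex, dite_true]
    rw [hz.injective hex.choose_spec]
  show f (KaehlerDifferential.D K A (z i)) = c i
  rw [h1]
  simp only [f, e, LinearMap.comp_apply, LinearEquiv.coe_coe]
  rw [KaehlerDifferential.tensorKaehlerEquivOfFormallyEtale_symm_D_algebraMap]
  simp only [D0, LinearMap.liftBaseChange_tmul, one_smul, Derivation.liftKaehlerDifferential_comp_D]
  exact (MvPolynomial.mkDerivation_X _ _ _).trans h2

end deriv

section charts
open Function
variable {s : ℕ} {n : Fin s → ℕ}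

abbrev Idx (n : Fin s → ℕ) : Type := ∀ i, Fin (n i + 1)
abbrev Dlt (n : Fin s → ℕ) : Type := Σ i, Fin (n i)

lemma card_Dlt : Fintype.card (Dlt n) = ∑ i, n i := by simp [Dlt]
lemma card_Idx : Fintype.card (Idx n) = ∏ i, (n i + 1) := by simp [Idx]

def rk1 {A : Type*} [CommRing A] (u : ∀ i, Fin (n i + 1) → A) : Idx n → A :=
  fun t => ∏ i, u i (t i)

def chartVec {A : Type*} [CommRing A] (a : Dlt n → A) (i : Fin s) (g : Fin (n i + 1)) :
    Fin (n i + 1) → A :=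
  Fin.cases (motive := fun _ => Fin (n i + 1) → A)
    (Fin.cons 1 (fun τ => a ⟨i, τ⟩)) (fun τ => Pi.single τ.succ 1) g

def VV {A : Type*} [CommRing A] (a : Dlt n → A) (g : Idx n) : Idx n → A :=
  rk1 (fun i => chartVec a i (g i))

def GG {A : Type*} [CommRing A] (a : Dlt n → A) : Option (Dlt n) → Idx n → A
  | none => VV a 0
  | some d => VV a (update 0 d.1 d.2.succ)

def HH {A : Type*} [CommRing A] (a : Dlt n → A) (d e : Dlt n) : Idx n → A :=
  if d.1 = e.1 then 0 else VV a (update (update 0 e.1 e.2.succ) d.1 d.2.succ)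

section ring
variable {A : Type*} [CommRing A]

lemma chartVec_zero (a : Dlt n → A) (i : Fin s) :
    chartVec a i 0 = Fin.cons 1 (fun τ => a ⟨i, τ⟩) := rfl
lemma chartVec_succ (a : Dlt n → A) (i : Fin s) (τ : Fin (n i)) :
    chartVec a i τ.succ = Pi.single τ.succ 1 := rfl

lemma chartVec_zero_eq (a : Dlt n → A) (i : Fin s) :
    chartVec a i 0 = Pi.single 0 1 + ∑ τ, a ⟨i, τ⟩ • chartVec a i τ.succ := by
  funext x
  simp only [chartVec_zero, chartVec_succ, Pi.add_apply, Finset.sum_apply, Pi.smul_apply,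
    smul_eq_mul]
  refine Fin.cases ?_ (fun σ => ?_) x
  · simp [Pi.single_apply, (Fin.succ_ne_zero _).symm]
  · simp [Pi.single_apply, Fin.succ_ne_zero, Fin.succ_inj]

def invC (a : Dlt n → A) (i : Fin s) (x : Fin (n i + 1)) (g : Fin (n i + 1)) : A :=
  Fin.cases (motive := fun _ => A)
    (Fin.cases (motive := fun _ => A) 1 (fun τ => - a ⟨i, τ⟩) g)
    (fun σ => if g = σ.succ then 1 else 0) x

lemma invC_spec (a : Dlt n → A) (i : Fin s) (x : Fin (n i + 1)) (y : Fin (n i + 1)) :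
    (Pi.single x 1 : Fin (n i + 1) → A) y = ∑ g, invC a i x g * chartVec a i g y := by
  rw [Fin.sum_univ_succ]
  refine Fin.cases ?_ (fun σ => ?_) x
  · rw [chartVec_zero_eq]
    simp [invC, Pi.add_apply, Finset.sum_apply]
  · simp [invC, (Fin.succ_ne_zero _).symm, Fin.succ_inj, chartVec_succ]

lemma single_eq_sum_VV (a : Dlt n → A) (t : Idx n) :
    (Pi.single t 1 : Idx n → A) = ∑ g : Idx n, (∏ i, invC a i (t i) (g i)) • VV a g := by
  classical
  funext y
  have h1 : (Pi.single t 1 : Idx n → A) y = ∏ i, (Pi.single (t i) 1 : Fin (n i + 1) → A) (y i) := by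
    by_cases h : y = t
    · subst h; simp
    · obtain ⟨i, hi⟩ := Function.ne_iff.1 h
      rw [Finset.prod_eq_zero (Finset.mem_univ i) (by simp [hi])]
      simp [h]
  rw [h1, Finset.prod_congr rfl (fun i _ => invC_spec a i (t i) (y i)), Finset.prod_univ_sum]
  simp only [Finset.sum_apply, Pi.smul_apply, smul_eq_mul, VV, rk1, ← Finset.prod_mul_distrib]
  rw [Fintype.piFinset_univ]

lemma VV_update (a : Dlt n → A) (g : Idx n) (i : Fin s) (x : Fin (n i + 1)) (t : Idx n) :
    VV a (update g i x) t =
      chartVec a i x (t i) * ∏ j ∈ Finset.univ.erase i, chartVec a j (g j) (t j) := by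
  simp only [VV, rk1]
  rw [← Finset.mul_prod_erase _ _ (Finset.mem_univ i)]
  congr 1
  · simp
  · refine Finset.prod_congr rfl fun j hj => ?_
    rw [update_of_ne (Finset.ne_of_mem_erase hj)]

lemma GG_none (a : Dlt n → A) : GG a none = VV a 0 := rfl
lemma GG_some (a : Dlt n → A) (d : Dlt n) : GG a (some d) = VV a (update 0 d.1 d.2.succ) := rfl

end ring

lemma span_VV {A : Type*} [CommRing A] (a : Dlt n → A) :
    Submodule.span A (Set.range (VV a)) = ⊤ := by
  classical
  rw [eq_top_iff, ← (Pi.basisFun A (Idx n)).span_eq, Submodule.span_le]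
  rintro _ ⟨t, rfl⟩
  rw [Pi.basisFun_apply, single_eq_sum_VV a t]
  exact Submodule.sum_mem _ fun g _ =>
    Submodule.smul_mem _ _ (Submodule.subset_span ⟨g, rfl⟩)

lemma linearIndependent_VV {A : Type*} [Field A] (a : Dlt n → A) :
    LinearIndependent A (VV a) :=
  linearIndependent_of_top_le_span_of_card_eq_finrank (span_VV a).ge (by simp)

section der
variable {K : Type*} [Field K] {A : Type*} [Field A] [Algebra K A]

lemma leibniz_prod' {I : Type*} [DecidableEq I] (D : Derivation K A A) (S : Finset I) (f : I → A) :
    D (∏ i ∈ S, f i) = ∑ i ∈ S, D (f i) * ∏ j ∈ S.erase i, f j := by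
  induction S using Finset.induction_on with
  | empty => simp
  | insert i S hi ih =>
    rw [Finset.prod_insert hi, Derivation.leibniz, ih, Finset.sum_insert hi,
      Finset.erase_insert hi, add_comm, smul_eq_mul, smul_eq_mul, mul_comm, Finset.mul_sum]
    congr 1
    refine Finset.sum_congr rfl fun j hj => ?_
    have hij : i ≠ j := fun h => hi (h ▸ hj)
    rw [Finset.erase_insert_of_ne hij, Finset.prod_insert (by simp [hi])]
    ring

def Dv {J : Type*} (D : Derivation K A A) (v : J → A) : J → A := fun t => D (v t)

lemma Dv_add {J : Type*} (D : Derivation K A A) (v w : J → A) :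
    Dv D (v + w) = Dv D v + Dv D w := by funext t; simp [Dv]
lemma Dv_smul {J : Type*} (D : Derivation K A A) (c : A) (v : J → A) :
    Dv D (c • v) = c • Dv D v + D c • v := by
  funext t; simp [Dv, mul_comm]
lemma Dv_sum {J I : Type*} (D : Derivation K A A) (S : Finset I) (v : I → J → A) :
    Dv D (∑ i ∈ S, v i) = ∑ i ∈ S, Dv D (v i) := by
  funext t; simp [Dv]

lemma Dv_VV (D : Derivation K A A) (a : Dlt n → A) (g : Idx n) :
    Dv D (VV a g) = ∑ d : Dlt n, D (a d) • (if g d.1 = 0 then VV a (update g d.1 d.2.succ) else 0) := by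
  funext t
  have hchart : ∀ (i : Fin s) (γ x : Fin (n i + 1)), D (chartVec a i γ x) =
      if γ = 0 then ∑ τ, D (a ⟨i, τ⟩) * chartVec a i τ.succ x else 0 := by
    intro i γ x
    refine Fin.cases ?_ (fun σ => ?_) γ
    · rw [chartVec_zero_eq]
      simp only [Pi.add_apply, Finset.sum_apply, Pi.smul_apply, map_add, map_sum, if_true,
        chartVec_succ, Pi.single_apply]
      rw [show D (if x = 0 then (1:A) else 0) = 0 by split_ifs <;> simp, zero_add]
      refine Finset.sum_congr rfl fun τ _ => ?_
      split_ifs <;> simp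
    · rw [if_neg (Fin.succ_ne_zero _), chartVec_succ, Pi.single_apply]
      split_ifs <;> simp
  have h1 : Dv D (VV a g) t = ∑ i, D (chartVec a i (g i) (t i)) *
      ∏ j ∈ Finset.univ.erase i, chartVec a j (g j) (t j) :=
    leibniz_prod' D Finset.univ (fun i => chartVec a i (g i) (t i))
  rw [h1, Finset.sum_apply, Fintype.sum_sigma]
  refine Finset.sum_congr rfl fun i _ => ?_
  rw [hchart]
  by_cases h : g i = 0
  · rw [if_pos h, Finset.sum_mul]
    refine Finset.sum_congr rfl fun τ _ => ?_
    simp only [Pi.smul_apply, smul_eq_mul, if_pos h, VV_update]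
    ring
  · simp [h]

lemma Dv_GG_none (D : Derivation K A A) (a : Dlt n → A) :
    Dv D (GG a none) = ∑ d, D (a d) • GG a (some d) := by
  rw [GG_none, Dv_VV]; simp [GG_some]

lemma Dv_GG_some (D : Derivation K A A) (a : Dlt n → A) (e : Dlt n) :
    Dv D (GG a (some e)) = ∑ d, D (a d) • HH a d e := by
  rw [GG_some, Dv_VV]
  refine Finset.sum_congr rfl fun d _ => ?_
  congr 1
  unfold HH
  by_cases h : d.1 = e.1
  · rw [if_pos h, if_neg]
    rw [h]; simp [Fin.succ_ne_zero]
  · rw [if_neg h, if_pos]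
    rw [update_of_ne h]; rfl

end der
end charts

section count
variable {K : Type*} [Field K] {A : Type*} [Field A] [Algebra K A]

def Gen (K : Type*) [Field K] {A : Type*} [Field A] [Algebra K A] {J : Type*} (q : J → A) (d : ℕ) :
    Prop :=
  ∃ F : Fin d → MvPolynomial J K, AlgebraicIndependent K (fun c => MvPolynomial.aeval q (F c))

lemma isAlgebraic_of_subalgebra {B : Subalgebra K A} (C : Subalgebra K B) (D : Subalgebra K A)
    (h : ∀ c ∈ C, (c : A) ∈ D) (x : B) (hx : IsAlgebraic C x) : IsAlgebraic D (x : A) := by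
  obtain ⟨p, hp0, hpx⟩ := hx
  let φ : C →ₐ[K] D := (B.val.comp C.val).codRestrict D (fun c => h c c.2)
  have hφ : Function.Injective φ := by
    intro a b hab
    have := congrArg Subtype.val hab
    exact Subtype.ext (Subtype.ext this)
  refine ⟨p.map φ.toRingHom, (Polynomial.map_ne_zero_iff hφ).2 hp0, ?_⟩
  rw [Polynomial.aeval_def, Polynomial.eval₂_map]
  have h1 : (algebraMap D A).comp φ.toRingHom = (algebraMap B A).comp (algebraMap C B) := rfl
  rw [h1, show ((x : A)) = algebraMap B A x from rfl, ← Polynomial.hom_eval₂]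
  rw [Polynomial.aeval_def] at hpx
  rw [hpx, map_zero]

lemma gen_count {J Y : Type*} [Fintype Y] (q : J → A) (y : Y → A)
    (hq : ∀ t, q t ∈ Algebra.adjoin K (Set.range y)) (hg : Gen K q (Fintype.card Y)) :
    AlgebraicIndependent K y ∧ ∀ i, IsAlgebraic (Algebra.adjoin K (Set.range q)) (y i) := by
  obtain ⟨F, hF⟩ := hg
  set B := Algebra.adjoin K (Set.range y) with hB
  let y' : Y → B := fun i => ⟨y i, Algebra.subset_adjoin ⟨i, rfl⟩⟩
  let q' : J → B := fun t => ⟨q t, hq t⟩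
  have hq' : ∀ f : MvPolynomial J K, B.val (MvPolynomial.aeval q' f) = MvPolynomial.aeval q f := by
    intro f
    rw [← AlgHom.comp_apply, MvPolynomial.comp_aeval]; rfl
  have hf : AlgebraicIndependent K (fun c => MvPolynomial.aeval q' (F c)) := by
    refine AlgebraicIndependent.of_comp B.val ?_
    convert hF using 1
    funext c
    exact hq' _
  have htop : Algebra.adjoin K (Set.range y') = ⊤ := by
    have h1 : (Algebra.adjoin K (Set.range y')).map B.val = B := by
      rw [AlgHom.map_adjoin]
      have h0 : B.val '' Set.range y' = Set.range y := by
        rw [← Set.range_comp]; rfl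
      rw [h0]
    rw [eq_top_iff]
    rintro b -
    have : (b : A) ∈ (Algebra.adjoin K (Set.range y')).map B.val := by rw [h1]; exact b.2
    obtain ⟨c, hc, hcb⟩ := this
    have : c = b := Subtype.ext hcb
    rw [← this]; exact hc
  have halg : Algebra.IsAlgebraic (Algebra.adjoin K (Set.range y')) B := by
    constructor
    intro b
    exact isAlgebraic_algebraMap (⟨b, htop ▸ trivial⟩ : Algebra.adjoin K (Set.range y'))
  have hle := hf.lift_cardinalMk_le_trdeg
  have hy' : IsTranscendenceBasis K y' := by
    refine Algebra.IsAlgebraic.isTranscendenceBasis_of_lift_le_trdeg_of_finite K y' ?_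
    simp only [Cardinal.mk_fintype, Fintype.card_fin, Cardinal.lift_natCast] at hle ⊢
    have : ((Fintype.card Y : ℕ) : Cardinal) ≤ Algebra.trdeg K B := by simpa using hle
    simpa using this
  constructor
  · have := hy'.1.map' (f := B.val) Subtype.val_injective
    exact this
  · have hcard := hy'.lift_cardinalMk_eq_trdeg
    have hfb : IsTranscendenceBasis K (fun c => MvPolynomial.aeval q' (F c)) := by
      refine hf.isTranscendenceBasis_of_lift_trdeg_le_of_finite ?_
      simp only [Cardinal.mk_fintype, Fintype.card_fin, Cardinal.lift_natCast] at hcard ⊢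
      have : ((Fintype.card Y : ℕ) : Cardinal) = Algebra.trdeg K B := by simpa using hcard
      simp [← this]
    intro i
    have h1 := hfb.isAlgebraic.isAlgebraic (y' i)
    refine isAlgebraic_of_subalgebra _ _ ?_ _ h1
    intro c hc
    have h2 : Algebra.adjoin K (Set.range fun c => MvPolynomial.aeval q' (F c)) ≤
        (Algebra.adjoin K (Set.range q)).comap B.val := by
      rw [Algebra.adjoin_le_iff]
      rintro _ ⟨c, rfl⟩
      rw [SetLike.mem_coe, Subalgebra.mem_comap]
      simp only [hq']
      rw [Algebra.adjoin_range_eq_range_aeval]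
      exact ⟨_, rfl⟩
    exact h2 hc

lemma deriv_adjoin_zero {J : Type*} (D : Derivation K A A) (q : J → A) (h : ∀ t, D (q t) = 0) :
    ∀ b ∈ Algebra.adjoin K (Set.range q), D b = 0 := by
  intro b hb
  have : Set.EqOn D (0 : Derivation K A A) (Algebra.adjoin K (Set.range q)) := by
    apply Derivation.eqOn_adjoin
    rintro _ ⟨t, rfl⟩
    simpa using h t
  simpa using this hb

lemma deriv_zero_of_alg [CharZero K] {J Y : Type*} (D : Derivation K A A) (q : J → A) (y : Y → A)
    (h : ∀ i, IsAlgebraic (Algebra.adjoin K (Set.range q)) (y i))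
    (hq : ∀ t, D (q t) = 0) (i : Y) : D (y i) = 0 :=
  deriv_eq_zero_of_isAlgebraic D _ (deriv_adjoin_zero D q hq) _ (h i)

end count

section phi
open Function
variable {s : ℕ} {n : Fin s → ℕ}
variable {K : Type*} [Field K] {A : Type*} [Field A] [Algebra K A]
variable {L : Type*} [Fintype L]

/-- affine chart coordinates of the `l`-th summand -/
def ch (z : L → Option (Dlt n) → A) (l : L) : Dlt n → A := fun d => z l (some d)

def Phi (z : L → Option (Dlt n) → A) : Idx n → A := ∑ l, z l none • GG (ch z l) none

def zf (z : L → Option (Dlt n) → A) : L × Option (Dlt n) → A := fun x => z x.1 x.2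

def GF (a : L → Dlt n → A) : L × Option (Dlt n) → Idx n → A := fun x => GG (a x.1) x.2

lemma sum_GF (a : L → Dlt n → A) (c : L × Option (Dlt n) → A) :
    ∑ x, c x • GF a x = ∑ l, (c (l, none) • GG (a l) none + ∑ d, c (l, some d) • GG (a l) (some d)) := by
  rw [Fintype.sum_prod_type]
  refine Finset.sum_congr rfl fun l _ => ?_
  rw [Fintype.sum_option]; rfl

def dcoef (D : Derivation K A A) (z : L → Option (Dlt n) → A) : L × Option (Dlt n) → A
  | (l, none) => D (z l none)
  | (l, some d) => z l none * D (z l (some d))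

lemma Dv_Phi (D : Derivation K A A) (z : L → Option (Dlt n) → A) :
    Dv D (Phi z) = ∑ x, dcoef D z x • GF (ch z) x := by
  rw [sum_GF, Phi, Dv_sum]
  refine Finset.sum_congr rfl fun l _ => ?_
  rw [Dv_smul, Dv_GG_none, add_comm, Finset.smul_sum]
  simp only [dcoef, ch, smul_smul]

lemma VV_mem (B : Subalgebra K A) (a : Dlt n → A) (ha : ∀ d, a d ∈ B) (g t : Idx n) :
    VV a g t ∈ B := by
  unfold VV rk1
  refine Subalgebra.prod_mem B fun i _ => ?_
  have : ∀ γ x : Fin (n i + 1), chartVec a i γ x ∈ B := by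
    intro γ x
    refine Fin.cases ?_ (fun σ => ?_) γ
    · rw [chartVec_zero]
      refine Fin.cases ?_ (fun σ => ?_) x
      · simpa using B.one_mem
      · simpa using ha _
    · rw [chartVec_succ, Pi.single_apply]
      split_ifs
      exacts [B.one_mem, B.zero_mem]
  exact this _ _

lemma GG_mem (B : Subalgebra K A) (a : Dlt n → A) (ha : ∀ d, a d ∈ B) (c) (t : Idx n) :
    GG a c t ∈ B := by
  cases c with
  | none => exact VV_mem B a ha _ _
  | some d => exact VV_mem B a ha _ _

lemma Phi_mem (z : L → Option (Dlt n) → A) (t : Idx n) :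
    Phi z t ∈ Algebra.adjoin K (Set.range (zf z)) := by
  rw [Phi, Finset.sum_apply]
  refine Subalgebra.sum_mem _ fun l _ => ?_
  have h0 : z l none ∈ Algebra.adjoin K (Set.range (zf z)) :=
    Algebra.subset_adjoin ⟨(l, none), rfl⟩
  rw [Pi.smul_apply, smul_eq_mul]
  have h1 : ∀ d, ch z l d ∈ Algebra.adjoin K (Set.range (zf z)) :=
    fun d => Algebra.subset_adjoin ⟨(l, some d), rfl⟩
  exact Subalgebra.mul_mem _ h0 (GG_mem _ _ h1 _ _)

lemma card_flat : Fintype.card (L × Option (Dlt n)) = Fintype.card L * (∑ i, n i + 1) := by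
  simp

lemma Phi_gen (z : L → Option (Dlt n) → A)
    (hg : Gen K (Phi z) (Fintype.card L * (∑ i, n i + 1))) :
    AlgebraicIndependent K (zf z) ∧
      ∀ x, IsAlgebraic (Algebra.adjoin K (Set.range (Phi z))) (zf z x) := by
  rw [← card_flat] at hg
  exact gen_count (Phi z) (zf z) (Phi_mem z) hg

/-- C2 -/
lemma GF_linearIndependent [CharZero K] (z : L → Option (Dlt n) → A)
    (h1 : AlgebraicIndependent K (zf z))
    (h2 : ∀ x, IsAlgebraic (Algebra.adjoin K (Set.range (Phi z))) (zf z x)) :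
    LinearIndependent A (GF (ch z)) := by
  rw [Fintype.linearIndependent_iff]
  intro c hc
  have hne : ∀ l, z l none ≠ 0 := fun l => h1.ne_zero (l, none)
  obtain ⟨D, hD⟩ := exists_deriv h1
    (fun x => match x with
      | (l, none) => c (l, none)
      | (l, some d) => c (l, some d) / z l none)
  have hco : dcoef D z = c := by
    funext x
    obtain ⟨l, _ | d⟩ := x
    · exact hD (l, none)
    · have := hD (l, some d)
      simp only [zf] at this
      simp only [dcoef, this]
      field_simp [hne l]
  have h0 : Dv D (Phi z) = 0 := by rw [Dv_Phi, hco, hc]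
  have h3 := deriv_zero_of_alg D (Phi z) (zf z) h2 (fun t => congrFun h0 t)
  rw [← hco]
  rintro ⟨l, _ | d⟩
  · exact h3 (l, none)
  · have := h3 (l, some d)
    simp only [zf] at this
    simp [dcoef, this]

lemma rk1_smul (c : Fin s → A) (u : ∀ i, Fin (n i + 1) → A) :
    rk1 (fun i => c i • u i) = (∏ i, c i) • rk1 u := by
  funext t; simp [rk1, Finset.prod_mul_distrib]

/-- C3 -/
lemma exists_chart (u : L → ∀ i, Fin (n i + 1) → A)
    (hg : Gen K (∑ l, rk1 (u l)) (Fintype.card L * (∑ i, n i + 1))) :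
    ∃ z : L → Option (Dlt n) → A, ∀ l, rk1 (u l) = z l none • GG (ch z l) none := by
  classical
  have hpiv : ∀ l i, ∃ p : Fin (n i + 1), (u l i p = 0 → u l i = 0) ∧ (p ≠ 0 → u l i 0 = 0) := by
    intro l i
    by_cases h0 : u l i 0 = 0
    · by_cases h : ∃ x, u l i x ≠ 0
      · obtain ⟨x, hx⟩ := h
        exact ⟨x, fun h => absurd h hx, fun _ => h0⟩
      · push Not at h
        exact ⟨0, fun _ => funext h, fun _ => h0⟩
    · exact ⟨0, fun h => absurd h h0, fun h => absurd rfl h⟩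
  choose p hp0 hp1 using hpiv
  let y : L → Option (Dlt n) → A := fun l c => match c with
    | none => ∏ i, u l i (p l i)
    | some d => u l d.1 ((p l d.1).succAbove d.2) / u l d.1 (p l d.1)
  have hmem : ∀ t, (∑ l, rk1 (u l)) t ∈ Algebra.adjoin K (Set.range (zf y)) := by
    intro t
    rw [Finset.sum_apply]
    refine Subalgebra.sum_mem _ fun l _ => ?_
    have hw : ∀ i, ∃ w ∈ Algebra.adjoin K (Set.range (zf y)), u l i (t i) = u l i (p l i) * w := by
      intro i
      by_cases hz : u l i (p l i) = 0
      · exact ⟨0, Subalgebra.zero_mem _, by rw [hp0 l i hz]; simp⟩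
      by_cases ht : t i = p l i
      · exact ⟨1, Subalgebra.one_mem _, by rw [ht, mul_one]⟩
      · obtain ⟨τ, hτ⟩ := Fin.exists_succAbove_eq ht
        refine ⟨y l (some ⟨i, τ⟩), Algebra.subset_adjoin ⟨(l, some ⟨i, τ⟩), rfl⟩, ?_⟩
        simp only [y, hτ]
        field_simp
    choose w hw1 hw2 using hw
    have : rk1 (u l) t = y l none * ∏ i, w i := by
      simp only [rk1, y, ← Finset.prod_mul_distrib]
      exact Finset.prod_congr rfl fun i _ => hw2 i
    rw [this]
    exact Subalgebra.mul_mem _ (Algebra.subset_adjoin ⟨(l, none), rfl⟩)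
      (Subalgebra.prod_mem _ fun i _ => hw1 i)
  rw [← card_flat] at hg
  have hy := (gen_count _ (zf y) hmem hg).1
  have hne : ∀ x, zf y x ≠ 0 := fun x => hy.ne_zero x
  have hpi : ∀ l i, p l i = 0 := by
    intro l i
    by_contra h
    obtain ⟨τ, hτ⟩ := Fin.exists_succAbove_eq (Ne.symm h)
    apply hne (l, some ⟨i, τ⟩)
    simp only [zf, y, hτ, hp1 l i h, zero_div]
  refine ⟨y, fun l => ?_⟩
  have hu0 : ∀ i, u l i 0 ≠ 0 := by
    intro i h
    apply hne (l, none)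
    simp only [zf, y]
    exact Finset.prod_eq_zero (Finset.mem_univ i) (by rw [hpi]; exact h)
  have hu : u l = fun i => u l i 0 • chartVec (ch y l) i 0 := by
    funext i x
    rw [chartVec_zero]
    refine Fin.cases ?_ (fun σ => ?_) x
    · simp
    · simp only [ch, y, hpi, Pi.smul_apply, smul_eq_mul, Fin.cons_succ, Fin.succAbove_zero]
      field_simp [hu0 i]
  rw [hu, rk1_smul]
  have : y l none = ∏ i, u l i 0 := by
    simp only [y, hpi]
  rw [this]
  rfl

end phi

section W
open Function
variable {s : ℕ} {n : Fin s → ℕ}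
variable {K : Type*} [Field K]
variable {L : Type*} [Fintype L]

def InW {A : Type*} [Field A] (a : L → Dlt n → A) (l : L) (w : Dlt n → A) : Prop :=
  ∀ e, ∑ d, w d • HH (a l) d e ∈ Submodule.span A (Set.range (GF a))

def afl {A : Type*} (a : L → Dlt n → A) : L × Dlt n → A := fun x => a x.1 x.2

lemma chartVec_map {R R' : Type*} [CommRing R] [CommRing R'] (φ : R →+* R') (a : Dlt n → R)
    (i : Fin s) (g x : Fin (n i + 1)) :
    chartVec (fun d => φ (a d)) i g x = φ (chartVec a i g x) := by
  refine Fin.cases ?_ (fun σ => ?_) g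
  · rw [chartVec_zero, chartVec_zero]
    refine Fin.cases ?_ (fun σ => ?_) x <;> simp
  · rw [chartVec_succ, chartVec_succ, Pi.single_apply, Pi.single_apply]
    split_ifs <;> simp

lemma VV_map {R R' : Type*} [CommRing R] [CommRing R'] (φ : R →+* R') (a : Dlt n → R)
    (g t : Idx n) : VV (fun d => φ (a d)) g t = φ (VV a g t) := by
  simp only [VV, rk1, chartVec_map, map_prod]

lemma GG_map {R R' : Type*} [CommRing R] [CommRing R'] (φ : R →+* R') (a : Dlt n → R)
    (c) (t : Idx n) : GG (fun d => φ (a d)) c t = φ (GG a c t) := by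
  cases c <;> exact VV_map _ _ _ _

lemma HH_map {R R' : Type*} [CommRing R] [CommRing R'] (φ : R →+* R') (a : Dlt n → R)
    (d e) (t : Idx n) : HH (fun d => φ (a d)) d e t = φ (HH a d e t) := by
  unfold HH
  split_ifs
  · simp
  · exact VV_map _ _ _ _

lemma exists_field_hom {A I : Type*} [Field A] [Algebra K A] (b : I → A)
    (hb : AlgebraicIndependent K b) :
    ∃ φ : FractionRing (MvPolynomial I K) →+* A,
      ∀ i, φ (algebraMap (MvPolynomial I K) _ (MvPolynomial.X i)) = b i := by
  have hinj : Function.Injective (MvPolynomial.aeval b : MvPolynomial I K →ₐ[K] A).toRingHom := hb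
  refine ⟨IsFractionRing.lift hinj, fun i => ?_⟩
  rw [IsFractionRing.lift_algebraMap]
  simp

lemma transfer {A A' : Type*} [Field A] [Field A'] [Algebra K A] [Algebra K A']
    (b : L → Dlt n → A) (b' : L → Dlt n → A') (hb : AlgebraicIndependent K (afl b))
    (hb' : AlgebraicIndependent K (afl b')) (l : L) (w : Dlt n → A) (hw : w ≠ 0)
    (hin : InW b l w) : ∃ w' : Dlt n → A', w' ≠ 0 ∧ InW b' l w' := by
  obtain ⟨φ, hφ⟩ := exists_field_hom _ hb
  obtain ⟨φ', hφ'⟩ := exists_field_hom _ hb'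
  set F := FractionRing (MvPolynomial (L × Dlt n) K)
  let a0 : L → Dlt n → F := fun l d => algebraMap (MvPolynomial (L × Dlt n) K) _ (MvPolynomial.X (l, d))
  have hba : ∀ l, b l = fun d => φ (a0 l d) := fun l => funext fun d => (hφ (l, d)).symm
  have hba' : ∀ l, b' l = fun d => φ' (a0 l d) := fun l => funext fun d => (hφ' (l, d)).symm
  let _ : Algebra F A := φ.toAlgebra
  have hsm : ∀ (x : F) (y : A), φ x * y = x • y := fun x y => rfl
  obtain ⟨d0, hd0⟩ := Function.ne_iff.1 hw
  obtain ⟨f, hf⟩ : ∃ f : A →ₗ[F] F, f (w d0) ≠ 0 := by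
    by_contra h
    push Not at h
    exact hd0 ((Module.forall_dual_apply_eq_zero_iff F (w d0)).1 h)
  refine ⟨fun d => φ' (f (w d)), ?_, ?_⟩
  · intro h
    exact hf (φ'.injective (by simpa using congrFun h d0))
  · intro e
    have h1 := hin e
    rw [Submodule.mem_span_range_iff_exists_fun] at h1 ⊢
    obtain ⟨c, hc⟩ := h1
    refine ⟨fun x => φ' (f (c x)), ?_⟩
    funext t
    have h2 := congrArg f (congrFun hc t)
    simp only [Finset.sum_apply, Pi.smul_apply, smul_eq_mul, GF, hba, GG_map, HH_map] at h2
    simp only [mul_comm _ (φ _), hsm, map_sum, map_smul] at h2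
    have h3 := congrArg φ' h2
    simp only [Finset.sum_apply, Pi.smul_apply, smul_eq_mul, GF, hba', GG_map, HH_map]
    simpa only [map_sum, smul_eq_mul, map_mul, mul_comm] using h3

/-- relative version of W -/
def WS {A : Type*} [Field A] (a : L → Dlt n → A) (l : L) (S : Set L) : Submodule A (Dlt n → A) where
  carrier := {w | ∀ e, ∑ d, w d • HH (a l) d e ∈ Submodule.span A (GF a '' {x | x.1 ∈ S})}
  add_mem' := by
    intro v w hv hw e
    have := Submodule.add_mem _ (hv e) (hw e)
    simpa only [Pi.add_apply, add_smul, Finset.sum_add_distrib] using this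
  zero_mem' := by intro e; simp
  smul_mem' := by
    intro c v hv e
    have := Submodule.smul_mem _ c (hv e)
    simpa only [Pi.smul_apply, smul_eq_mul, mul_smul, Finset.smul_sum] using this

lemma mem_WS {A : Type*} [Field A] (a : L → Dlt n → A) (l : L) (S : Set L) (w) :
    w ∈ WS a l S ↔ ∀ e, ∑ d, w d • HH (a l) d e ∈ Submodule.span A (GF a '' {x | x.1 ∈ S}) :=
  Iff.rfl

lemma WS_mono {A : Type*} [Field A] (a : L → Dlt n → A) (l : L) {S T : Set L} (h : S ⊆ T) :
    WS a l S ≤ WS a l T := by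
  intro w hw
  rw [mem_WS] at hw ⊢
  intro e
  have h1 : {x : L × Option (Dlt n) | x.1 ∈ S} ⊆ {x | x.1 ∈ T} := fun x hx => h hx
  exact Submodule.span_mono (Set.image_mono h1) (hw e)

lemma WS_comp {A : Type*} [Field A] {M : Type*} [Fintype M] (a : M → Dlt n → A) (σ : L → M) (l : L)
    (w : Dlt n → A) : InW (fun i => a (σ i)) l w ↔ w ∈ WS a (σ l) (Set.range σ) := by
  have : Set.range (GF (fun i => a (σ i))) = GF a '' {x | x.1 ∈ Set.range σ} := by
    ext v
    constructor
    · rintro ⟨x, rfl⟩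
      exact ⟨(σ x.1, x.2), ⟨x.1, rfl⟩, rfl⟩
    · rintro ⟨⟨_, c⟩, ⟨i, rfl⟩, rfl⟩
      exact ⟨(i, c), rfl⟩
  rw [mem_WS, ← this]; rfl

lemma update2_inj {d d' e : Dlt n} (h : d.1 ≠ e.1) (h' : d'.1 ≠ e.1)
    (heq : update (update (0 : Idx n) e.1 e.2.succ) d.1 d.2.succ =
      update (update (0 : Idx n) e.1 e.2.succ) d'.1 d'.2.succ) : d = d' := by
  obtain ⟨i, τ⟩ := d
  obtain ⟨i', τ'⟩ := d'
  simp only at h h' heq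
  have h1 := congrFun heq i
  rw [update_self] at h1
  by_cases hi : i = i'
  · subst hi
    rw [update_self, Fin.succ_inj] at h1
    rw [h1]
  · rw [update_of_ne hi, update_of_ne h] at h1
    exact absurd h1 (Fin.succ_ne_zero _)

lemma WS_single {A : Type*} [Field A] (a : L → Dlt n → A) (l : L)
    (hs : ∀ d : Dlt n, ∃ e : Dlt n, d.1 ≠ e.1) : WS a l {l} = ⊥ := by
  classical
  rw [eq_bot_iff]
  intro w hw
  rw [Submodule.mem_bot]
  funext d0
  obtain ⟨e, he⟩ := hs d0
  have h1 := hw e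
  have hV := linearIndependent_VV (a l)
  let β : Module.Basis (Idx n) A (Idx n → A) := Module.Basis.mk hV (span_VV (a l)).ge
  let g0 : Idx n := update (update 0 e.1 e.2.succ) d0.1 d0.2.succ
  have hβ : ∀ g, β.coord g0 (VV (a l) g) = if g = g0 then 1 else 0 := by
    intro g
    have : VV (a l) g = β g := (Module.Basis.mk_apply _ _ g).symm
    rw [this, Module.Basis.coord_apply, Module.Basis.repr_self, Finsupp.single_apply]
  have h2 : β.coord g0 (∑ d, w d • HH (a l) d e) = 0 := by
    have hle : Submodule.span A (GF a '' {x | x.1 ∈ ({l} : Set L)}) ≤ LinearMap.ker (β.coord g0) := by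
      rw [Submodule.span_le]
      rintro _ ⟨⟨l', c⟩, hl, rfl⟩
      simp only [Set.mem_setOf_eq, Set.mem_singleton_iff] at hl
      subst hl
      show β.coord g0 (GG (a l') c) = 0
      have hg1 : g0 d0.1 ≠ 0 := by simp [g0, Fin.succ_ne_zero]
      have hg2 : g0 e.1 ≠ 0 := by
        simp only [g0]; rw [update_of_ne he.symm, update_self]; exact Fin.succ_ne_zero _
      cases c with
      | none =>
        rw [GG_none, hβ, if_neg]
        intro h; rw [← h] at hg1; exact hg1 rfl
      | some d =>
        rw [GG_some, hβ, if_neg]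
        intro h
        rw [← h] at hg1 hg2
        have e1 : d0.1 = d.1 := by by_contra hne; exact hg1 (by rw [update_of_ne hne]; rfl)
        have e2 : e.1 = d.1 := by by_contra hne; exact hg2 (by rw [update_of_ne hne]; rfl)
        exact he (e1.trans e2.symm)
    exact hle h1
  rw [map_sum] at h2
  rw [Finset.sum_eq_single d0] at h2
  · rw [map_smul, HH, if_neg he, hβ, if_pos rfl] at h2
    simpa using h2
  · intro d _ hd
    rw [map_smul, HH]
    split_ifs with h
    · simp
    · rw [hβ, if_neg, smul_zero]
      intro heq
      exact hd (update2_inj h he heq)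
  · simp

lemma exists_embedding {M : Type*} [Fintype M] [DecidableEq M] (S : Finset M) (l : M) (hl : l ∈ S)
    (l0 : L) (hc : S.card = Fintype.card L) :
    ∃ σ : L → M, Injective σ ∧ σ l0 = l ∧ Set.range σ = S := by
  classical
  have e : L ≃ S := Fintype.equivOfCardEq (by simp [hc])
  refine ⟨fun x => (Equiv.swap (⟨l, hl⟩ : S) (e l0) (e x) : S), ?_, ?_, ?_⟩
  · intro x y h
    exact e.injective ((Equiv.swap _ _).injective (Subtype.ext h))
  · simp
  · ext x
    simp only [Set.mem_range, Finset.mem_coe]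
    constructor
    · rintro ⟨y, rfl⟩; exact Subtype.property _
    · intro hx
      refine ⟨e.symm ((Equiv.swap (⟨l, hl⟩ : S) (e l0)).symm ⟨x, hx⟩), ?_⟩
      simp

lemma WS_inter {E M : Type*} [Field E] [Fintype M] (a : M → Dlt n → E)
    (hLI : LinearIndependent E (GF a)) (l e1 : M) (S : Set M) (he1 : e1 ∈ S) (he1l : e1 ≠ l)
    (w : Dlt n → E) (h : ∀ e ∈ S, e ≠ l → w ∈ WS a l (S \ {e})) : w ∈ WS a l {l} := by
  intro d
  have h1 : ∀ e ∈ S, e ≠ l → ∃ f ∈ Finsupp.supported E E {x : M × Option (Dlt n) | x.1 ∈ S \ {e}},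
      Finsupp.linearCombination E (GF a) f = ∑ d', w d' • HH (a l) d' d := by
    intro e he hel
    exact (Finsupp.mem_span_image_iff_linearCombination E).1 (h e he hel d)
  obtain ⟨f1, hf1, hf1'⟩ := h1 e1 he1 he1l
  refine (Finsupp.mem_span_image_iff_linearCombination E).2 ⟨f1, ?_, hf1'⟩
  rw [Finsupp.mem_supported]
  intro x hx
  by_contra hxl
  have hxl : x.1 ≠ l := hxl
  have hxS : x.1 ∈ S := ((Finsupp.mem_supported E f1).1 hf1 hx).1
  obtain ⟨f2, hf2, hf2'⟩ := h1 x.1 hxS hxl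
  have : f1 = f2 := hLI (hf1'.trans hf2'.symm)
  rw [this] at hx
  exact ((Finsupp.mem_supported E f2).1 hf2 hx).2 rfl

lemma stable_span {E M : Type*} [Field E] [Algebra K E] (v : M → Idx n → E) (D : Derivation K E E)
    (h : ∀ x, Dv D (v x) ∈ Submodule.span E (Set.range v)) (y : Idx n → E)
    (hy : y ∈ Submodule.span E (Set.range v)) : Dv D y ∈ Submodule.span E (Set.range v) := by
  induction hy using Submodule.span_induction with
  | mem x hx => obtain ⟨i, rfl⟩ := hx; exact h i
  | zero =>
    have : Dv D (0 : Idx n → E) = 0 := by funext t; simp [Dv]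
    rw [this]; exact Submodule.zero_mem _
  | add x y _ _ hx hy => rw [Dv_add]; exact Submodule.add_mem _ hx hy
  | smul c x hx hx' =>
    rw [Dv_smul]
    exact Submodule.add_mem _ (Submodule.smul_mem _ _ hx') (Submodule.smul_mem _ _ hx)

lemma WS_univ_ne_top [CharZero K] {E M : Type*} [Field E] [Algebra K E] [Fintype M]
    (a : M → Dlt n → E) (ha : AlgebraicIndependent K (afl a)) (l : M)
    (hcard : Fintype.card M * (∑ i, n i + 1) < Fintype.card (Idx n)) :
    WS a l Set.univ ≠ ⊤ := by
  classical
  intro htop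
  set Q := Submodule.span E (Set.range (GF a)) with hQ
  have hH : ∀ d e, HH (a l) d e ∈ Q := by
    intro d e
    have h1 : (Pi.single d 1 : Dlt n → E) ∈ WS a l Set.univ := htop ▸ trivial
    have h2 := h1 e
    rw [Finset.sum_eq_single d (by intro d' _ h; simp [h]) (by simp)] at h2
    simpa using h2
  have hder : ∀ d : Dlt n, ∃ D : Derivation K E E, (∀ d', D (a l d') = if d' = d then 1 else 0) ∧
      ∀ y ∈ Q, Dv D y ∈ Q := by
    intro d
    obtain ⟨D, hD⟩ := exists_deriv ha (fun x => if x = (l, d) then 1 else 0)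
    have hD' : ∀ l' d', D (a l' d') = if (l', d') = (l, d) then 1 else 0 := fun l' d' => hD (l', d')
    refine ⟨D, fun d' => by rw [hD']; simp, ?_⟩
    refine stable_span (GF a) D ?_
    rintro ⟨l', c⟩
    by_cases hl : l' = l
    · subst hl
      cases c with
      | none =>
        show Dv D (GG (a l') none) ∈ _
        rw [Dv_GG_none]
        exact Submodule.sum_mem _ fun d _ => Submodule.smul_mem _ _
          (Submodule.subset_span ⟨(l', some d), rfl⟩)
      | some e =>
        show Dv D (GG (a l') (some e)) ∈ _
        rw [Dv_GG_some]
        exact Submodule.sum_mem _ fun d _ => Submodule.smul_mem _ _ (hH d e)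
    · have h0 : ∀ d', D (a l' d') = 0 := by intro d'; rw [hD']; simp [hl]
      cases c with
      | none =>
        show Dv D (GG (a l') none) ∈ _
        rw [Dv_GG_none]; simp [h0]
      | some e =>
        show Dv D (GG (a l') (some e)) ∈ _
        rw [Dv_GG_some]; simp [h0]
  have hV : ∀ (S : Finset (Fin s)) (g : Idx n), (∀ i ∉ S, g i = 0) → VV (a l) g ∈ Q := by
    intro S
    induction S using Finset.induction_on with
    | empty =>
      intro g hg
      have : g = 0 := funext fun i => hg i (by simp)
      rw [this]
      exact Submodule.subset_span ⟨(l, none), rfl⟩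
    | insert i S hi ih =>
      intro g hg
      by_cases h0 : g i = 0
      · refine ih g fun j hj => ?_
        by_cases hji : j = i
        · rw [hji, h0]
        · exact hg j (by simp [hji, hj])
      · obtain ⟨τ, hτ⟩ := Fin.exists_succ_eq.2 h0
        have h1 : VV (a l) (update g i 0) ∈ Q := by
          refine ih _ fun j hj => ?_
          by_cases hji : j = i
          · subst hji; simp
          · rw [update_of_ne hji]; exact hg j (by simp [hji, hj])
        obtain ⟨D, hD, hDQ⟩ := hder ⟨i, τ⟩
        have h2 := hDQ _ h1
        rw [Dv_VV, Finset.sum_eq_single ⟨i, τ⟩] at h2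
        · rw [hD, if_pos rfl, one_smul, if_pos (by simp)] at h2
          simp only [update_idem] at h2
          rw [hτ, update_eq_self] at h2
          exact h2
        · intro d _ hd
          rw [hD, if_neg hd, zero_smul]
        · simp
  have hQtop : Q = ⊤ := by
    rw [eq_top_iff, ← span_VV (a l), Submodule.span_le]
    rintro _ ⟨g, rfl⟩
    exact hV Finset.univ g (by simp)
  have h1 := finrank_range_le_card (R := E) (GF a)
  rw [Set.finrank, ← hQ, hQtop, finrank_top, Module.finrank_fintype_fun_eq_card, card_flat] at h1
  omega

lemma Wzero [CharZero K] {E M A : Type*} [Field E] [Algebra K E] [Fintype M] [Field A] [Algebra K A]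
    (a : M → Dlt n → E) (ha : AlgebraicIndependent K (afl a)) (hLI : LinearIndependent E (GF a))
    (hs : ∀ d : Dlt n, ∃ e : Dlt n, d.1 ≠ e.1)
    (hcard : Fintype.card M * (∑ i, n i + 1) < Fintype.card (Idx n))
    (hLM : Fintype.card L + ∑ i, n i ≤ Fintype.card M + 1) (hN : 0 < ∑ i, n i)
    (b : L → Dlt n → A) (hb : AlgebraicIndependent K (afl b)) (l0 : L) (w : Dlt n → A)
    (hw : InW b l0 w) : w = 0 := by
  classical
  by_contra hw0
  have hL : 0 < Fintype.card L := Fintype.card_pos_iff.2 ⟨l0⟩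
  have hbase : ∀ (S : Finset M) (l : M), l ∈ S → S.card = Fintype.card L → WS a l S ≠ ⊥ := by
    intro S l hl hc
    obtain ⟨σ, hσ, hσl, hσS⟩ := exists_embedding S l hl l0 hc
    have hai : AlgebraicIndependent K (afl (fun i => a (σ i))) :=
      ha.comp (fun x : L × Dlt n => (σ x.1, x.2)) (by
        rintro ⟨x, d⟩ ⟨y, d'⟩ h
        simp only [Prod.mk.injEq] at h
        rw [hσ h.1, h.2])
    obtain ⟨w', hw', hin⟩ := transfer b (fun i => a (σ i)) hb hai l0 w hw0 hw
    rw [WS_comp, hσl, hσS] at hin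
    intro h
    rw [h] at hin
    exact hw' (by simpa using hin)
  have hind : ∀ (i : ℕ) (S : Finset M) (l : M), l ∈ S → S.card = Fintype.card L + i →
      i + 1 ≤ Module.finrank E (WS a l S) := by
    intro i
    induction i with
    | zero =>
      intro S l hl hc
      rw [zero_add]
      exact (Submodule.one_le_finrank_iff).2 (hbase S l hl hc)
    | succ i ih =>
      intro S l hl hc
      have hS2 : 1 < S.card := by omega
      obtain ⟨e1, he1, he1l⟩ := Finset.exists_mem_ne hS2 l
      have key : ∃ e ∈ S, e ≠ l ∧ WS a l ((S : Set M) \ {e}) ≠ WS a l S := by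
        by_contra hcon
        push Not at hcon
        have hbot : WS a l (S : Set M) ≤ ⊥ := by
          intro v hv
          rw [← WS_single a l hs]
          exact WS_inter a hLI l e1 S he1 he1l v fun e he hel => by rw [hcon e he hel]; exact hv
        have h1 := ih (S.erase e1) l (Finset.mem_erase.2 ⟨he1l.symm, hl⟩)
          (by rw [Finset.card_erase_of_mem he1]; omega)
        have h2 : WS a l (S.erase e1 : Finset M) = ⊥ :=
          le_bot_iff.1 ((WS_mono a l (by simp)).trans hbot)
        rw [h2] at h1
        simp at h1
      obtain ⟨e, he, hel, hne⟩ := key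
      have h1 := ih (S.erase e) l (Finset.mem_erase.2 ⟨hel.symm, hl⟩)
          (by rw [Finset.card_erase_of_mem he]; omega)
      rw [Finset.coe_erase] at h1
      have h2 := Submodule.finrank_lt_finrank_of_lt
        (lt_of_le_of_ne (WS_mono a l (S := (S : Set M) \ {e}) (T := S) Set.diff_subset) hne)
      omega
  have hM : 0 < Fintype.card M := by omega
  obtain ⟨l⟩ := Fintype.card_pos_iff.1 hM
  have h1 := hind (Fintype.card M - Fintype.card L) Finset.univ l (Finset.mem_univ _)
    (by rw [Finset.card_univ]; omega)
  rw [Finset.coe_univ] at h1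
  refine WS_univ_ne_top a ha l hcard ?_
  apply Submodule.eq_top_of_finrank_eq
  refine le_antisymm (Submodule.finrank_le _) ?_
  rw [Module.finrank_fintype_fun_eq_card, card_Dlt]
  omega

end W

section U
open Function
variable {s : ℕ} {n : Fin s → ℕ}
variable {K : Type*} [Field K] [CharZero K]
variable {L : Type*} [Fintype L]
variable {A : Type*} [Field A] [Algebra K A]

lemma GG_none_ne_zero (a : Dlt n → A) : GG a none ≠ 0 := by
  intro h
  have := congrFun h 0
  simp [GG_none, VV, rk1, chartVec_zero] at this

lemma GF_mem_span (p x : L → Option (Dlt n) → A) (hpx : Phi p = Phi x)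
    (hp : AlgebraicIndependent K (zf p)) (y) :
    GF (ch p) y ∈ Submodule.span A (Set.range (GF (ch x))) := by
  classical
  have hne : ∀ l, p l none ≠ 0 := fun l => hp.ne_zero (l, none)
  obtain ⟨D, hD⟩ := exists_deriv hp
    (fun z => if z = y then (match y with
      | (_, none) => 1
      | (l, some _) => (p l none)⁻¹) else 0)
  have hco : dcoef D p = Pi.single y 1 := by
    funext z
    have hz := hD z
    by_cases h : z = y
    · subst h
      obtain ⟨l, _ | d⟩ := z
      · simp [zf] at hz; simp [dcoef, hz]
      · simp [zf] at hz; simp [dcoef, hz, hne l]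
    · obtain ⟨l, _ | d⟩ := z
      · simp [zf, h] at hz; simp [dcoef, hz, h]
      · simp [zf, h] at hz; simp [dcoef, hz, h]
  have h1 : Dv D (Phi p) = GF (ch p) y := by
    rw [Dv_Phi, hco, Finset.sum_eq_single y (by intro z _ h; simp [h]) (by simp)]
    simp
  rw [← h1, hpx, Dv_Phi]
  exact Submodule.sum_mem _ fun z _ => Submodule.smul_mem _ _ (Submodule.subset_span ⟨z, rfl⟩)

lemma trisecant (x : L → Option (Dlt n) → A) (hx : AlgebraicIndependent K (zf x))
    (hLI : LinearIndependent A (GF (ch x))) (hN : 0 < ∑ i, n i)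
    (a : Dlt n → A) (μ : L → A) (h : GG a none = ∑ l, μ l • GG (ch x l) none) :
    ∃ (l : L) (c : A), GG a none = c • GG (ch x l) none := by
  classical
  by_cases h0 : ∃ l1, μ l1 ≠ 0
  swap
  · push Not at h0
    exact absurd (by rw [h]; simp [h0]) (GG_none_ne_zero a)
  obtain ⟨l1, h1⟩ := h0
  by_cases h2 : ∃ l2, l2 ≠ l1 ∧ μ l2 ≠ 0
  swap
  · push Not at h2
    refine ⟨l1, μ l1, ?_⟩
    rw [h, Finset.sum_eq_single l1 (by intro l _ hl; rw [h2 l hl, zero_smul]) (by simp)]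
  exfalso
  obtain ⟨l2, hl, h2⟩ := h2
  let ll : Bool → L := fun b => if b then l1 else l2
  have hll : Injective ll := by
    intro b b' hb
    cases b <;> cases b' <;> simp_all [ll]
  have hμ : ∀ b, μ (ll b) ≠ 0 := by intro b; cases b <;> simp [ll, h1, h2]
  have hD : ∀ y : Bool × Dlt n, ∃ D : Derivation K A A, ∀ z, D (zf x z) =
      if z = (ll y.1, some y.2) then 1 else 0 := fun y => exists_deriv hx _
  choose D hD using hD
  let T : (Bool × Dlt n → A) →ₗ[A] (Dlt n → A) :=
    { toFun := fun c δ => ∑ y, c y * D y (a δ)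
      map_add' := by intro c c'; funext δ; simp [add_mul, Finset.sum_add_distrib]
      map_smul' := by intro r c; funext δ; simp [mul_assoc, Finset.mul_sum] }
  have hker : LinearMap.ker T ≠ ⊥ := by
    apply LinearMap.ker_ne_bot_of_finrank_lt
    rw [Module.finrank_fintype_fun_eq_card, Module.finrank_fintype_fun_eq_card, Fintype.card_prod,
      Fintype.card_bool, card_Dlt]
    omega
  obtain ⟨c, hc, hc0⟩ := Submodule.exists_mem_ne_zero_of_ne_bot hker
  let DD : Derivation K A A := ∑ y, c y • D y
  have hDD : ∀ z, DD z = ∑ y, c y * D y z := by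
    intro z
    have := congrArg (fun f : A → A => f z)
      (map_sum (Derivation.coeFnAddMonoidHom (R := K) (A := A) (M := A)) (fun y => c y • D y) Finset.univ)
    simp only [Finset.sum_apply] at this
    exact this
  have hDa : ∀ δ, DD (a δ) = 0 := by
    intro δ; rw [hDD]; exact congrFun hc δ
  have e1 : Dv DD (GG a none) = 0 := by rw [Dv_GG_none]; simp [hDa]
  let cf : L × Option (Dlt n) → A := fun y => match y with
    | (l, none) => DD (μ l)
    | (l, some d) => μ l * DD (x l (some d))
  have e2 : ∑ y, cf y • GF (ch x) y = 0 := by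
    rw [← e1, h, Dv_sum, sum_GF]
    refine Finset.sum_congr rfl fun l _ => ?_
    rw [Dv_smul, Dv_GG_none, add_comm, Finset.smul_sum]
    simp only [cf, ch, smul_smul]
  have e3 := Fintype.linearIndependent_iff.1 hLI cf e2
  apply hc0
  funext y
  have e4 : μ (ll y.1) * DD (x (ll y.1) (some y.2)) = 0 := e3 (ll y.1, some y.2)
  have e5 := (mul_eq_zero.1 e4).resolve_left (hμ _)
  rw [hDD, Finset.sum_eq_single y] at e5
  · have := hD y (ll y.1, some y.2)
    simp only [zf, if_true] at this
    rw [this] at e5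
    simpa using e5
  · intro y' _ hy'
    have := hD y' (ll y.1, some y.2)
    simp only [zf] at this
    rw [this, if_neg, mul_zero]
    intro heq
    simp only [Prod.mk.injEq, Option.some.injEq] at heq
    exact hy' (Prod.ext (hll heq.1).symm heq.2.symm)
  · simp

lemma uniqueness (p x : L → Option (Dlt n) → A) (hpx : Phi p = Phi x) (hN : 0 < ∑ i, n i)
    (hg : Gen K (Phi p) (Fintype.card L * (∑ i, n i + 1)))
    (hW : ∀ l w, InW (ch x) l w → w = 0) (l0 : L) :
    p l0 none ≠ 0 ∧ ∃ (l : L) (c : A), GG (ch p l0) none = c • (x l none • GG (ch x l) none) := by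
  classical
  obtain ⟨hp, hpa⟩ := Phi_gen p hg
  have hg' := hg
  rw [hpx] at hg'
  obtain ⟨hx, hxa⟩ := Phi_gen x hg'
  have hLI := GF_linearIndependent x hx hxa
  have hp0 : p l0 none ≠ 0 := hp.ne_zero (l0, none)
  refine ⟨hp0, ?_⟩
  obtain ⟨D, hD⟩ := exists_deriv hp (fun y => if y = (l0, none) then p l0 none else 0)
  have hDs : ∀ l d, D (ch p l d) = 0 := by
    intro l d
    have := hD (l, some d)
    simpa [zf, ch] using this
  have hDn : ∀ l, D (p l none) = if l = l0 then p l0 none else 0 := by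
    intro l
    have := hD (l, none)
    simpa [zf] using this
  have hspan : Submodule.span A (Set.range (GF (ch p))) = Submodule.span A (Set.range (GF (ch x))) := by
    apply le_antisymm
    · rw [Submodule.span_le]; rintro _ ⟨y, rfl⟩; exact GF_mem_span p x hpx hp y
    · rw [Submodule.span_le]; rintro _ ⟨y, rfl⟩; exact GF_mem_span x p hpx.symm hx y
  have hstab := stable_span (GF (ch p)) D (by
    rintro ⟨l, _ | e⟩
    · show Dv D (GG (ch p l) none) ∈ _
      rw [Dv_GG_none]; simp [hDs]
    · show Dv D (GG (ch p l) (some e)) ∈ _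
      rw [Dv_GG_some]; simp [hDs])
  rw [hspan] at hstab
  have hDx : ∀ l d, D (ch x l d) = 0 := by
    intro l
    have h1 : InW (ch x) l (fun d => D (ch x l d)) := by
      intro e
      rw [← Dv_GG_some]
      exact hstab _ (Submodule.subset_span ⟨(l, some e), rfl⟩)
    exact congrFun (hW l _ h1)
  have h1 : Dv D (Phi p) = p l0 none • GG (ch p l0) none := by
    rw [Phi, Dv_sum, Finset.sum_eq_single l0]
    · rw [Dv_smul, Dv_GG_none, hDn]; simp [hDs]
    · intro l _ hl
      rw [Dv_smul, Dv_GG_none, hDn]; simp [hDs, hl]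
    · simp
  have h2 : Dv D (Phi x) = ∑ l, D (x l none) • GG (ch x l) none := by
    rw [Phi, Dv_sum]
    refine Finset.sum_congr rfl fun l _ => ?_
    rw [Dv_smul, Dv_GG_none]; simp [hDx]
  rw [← hpx, h1] at h2
  obtain ⟨l, c, hc⟩ := trisecant x hx hLI hN (ch p l0) (fun l => (p l0 none)⁻¹ * D (x l none)) (by
    have := congrArg (fun v => (p l0 none)⁻¹ • v) h2
    simp only [smul_smul, inv_mul_cancel₀ hp0, one_smul, Finset.smul_sum] at this
    exact this)
  refine ⟨l, c * (x l none)⁻¹, ?_⟩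
  have hx0 : x l none ≠ 0 := hx.ne_zero (l, none)
  rw [smul_smul, mul_assoc, inv_mul_cancel₀ hx0, mul_one]
  exact hc

end U

section noether
variable {K : Type*} [Field K]

lemma noether_gen {J : Type*} [Finite J] {γ : Type*} [Preorder γ] (I : Ideal (MvPolynomial J K))
    (hI : I ≠ ⊤)
    (φ : γ → Ideal (MvPolynomial J K)) (hpr : ∀ x, (φ x).IsPrime) (hle : ∀ x, I ≤ φ x)
    (hanti : ∀ x y, x < y → φ y < φ x) (d : ℕ)
    (hd : (d : WithBot ℕ∞) ≤ Order.krullDim γ) :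
    ∃ F : Fin d → MvPolynomial J K, ∀ f : MvPolynomial (Fin d) K,
      MvPolynomial.aeval F f ∈ I → f = 0 := by
  haveI : Nontrivial (MvPolynomial J K ⧸ I) := Ideal.Quotient.nontrivial_iff.2 hI
  obtain ⟨s', g, hginj, hgint⟩ := exists_integral_inj_algHom_of_fg K (MvPolynomial J K ⧸ I)
  let R := MvPolynomial J K ⧸ I
  let ψ : γ → Ideal R := fun x => (φ x).map (Ideal.Quotient.mk I)
  have hcomap : ∀ x, (ψ x).comap (Ideal.Quotient.mk I) = φ x := by
    intro x
    rw [Ideal.comap_map_of_surjective _ Ideal.Quotient.mk_surjective]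
    rw [← RingHom.ker_eq_comap_bot, Ideal.mk_ker]
    exact sup_eq_left.2 (hle x)
  have hψp : ∀ x, (ψ x).IsPrime := by
    intro x
    haveI := hpr x
    refine Ideal.map_isPrime_of_surjective Ideal.Quotient.mk_surjective ?_
    rw [Ideal.mk_ker]; exact hle x
  have hψ : ∀ x y, x < y → ψ y < ψ x := by
    intro x y hxy
    refine lt_of_le_of_ne (Ideal.map_mono (hanti x y hxy).le) ?_
    intro h
    have := congrArg (Ideal.comap (Ideal.Quotient.mk I)) h
    rw [hcomap, hcomap] at this
    exact (hanti x y hxy).ne this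
  letI : Algebra (MvPolynomial (Fin s') K) R := g.toRingHom.toAlgebra
  haveI : Algebra.IsIntegral (MvPolynomial (Fin s') K) R := ⟨hgint⟩
  let ρ : γ → (PrimeSpectrum (MvPolynomial (Fin s') K))ᵒᵈ := fun x =>
    OrderDual.toDual ⟨(ψ x).comap (algebraMap (MvPolynomial (Fin s') K) R), by
      haveI := hψp x
      exact Ideal.comap_isPrime _ _⟩
  have hρ : StrictMono ρ := by
    intro x y hxy
    haveI := hψp y
    have := Ideal.IsIntegral.comap_lt_comap (R := MvPolynomial (Fin s') K) (hψ x y hxy)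
    exact OrderDual.toDual_lt_toDual.2 this
  have h1 := Order.krullDim_le_of_strictMono ρ hρ
  rw [Order.krullDim_orderDual] at h1
  have h2 : ringKrullDim (MvPolynomial (Fin s') K) = s' := by
    rw [MvPolynomial.ringKrullDim_of_isNoetherianRing]
    simp
  have h3 : (d : WithBot ℕ∞) ≤ s' := hd.trans (h1.trans h2.le)
  have h4 : d ≤ s' := by exact_mod_cast h3
  choose F hF using fun c : Fin s' => Ideal.Quotient.mk_surjective (I := I) (g (MvPolynomial.X c))
  refine ⟨fun c => F (Fin.castLE h4 c), ?_⟩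
  intro f hf
  have h5 : g (MvPolynomial.rename (Fin.castLE h4) f) =
      Ideal.Quotient.mk I (MvPolynomial.aeval (fun c => F (Fin.castLE h4 c)) f) := by
    have : (g.comp (MvPolynomial.rename (Fin.castLE h4))) =
        (Ideal.Quotient.mkₐ K I).comp (MvPolynomial.aeval (fun c => F (Fin.castLE h4 c))) := by
      apply MvPolynomial.algHom_ext
      intro c
      simp only [AlgHom.comp_apply, MvPolynomial.rename_X, MvPolynomial.aeval_X]
      exact (hF _).symm
    exact congrArg (fun h => h f) this
  rw [Ideal.Quotient.eq_zero_iff_mem.2 hf] at h5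
  have h6 := hginj (h5.trans (map_zero g).symm)
  exact (MvPolynomial.rename_injective _ (Fin.castLE_injective h4)) (h6.trans (map_zero _).symm)

end noether

section vanish
variable {K : Type*} [Field K] {J : Type*} [Fintype J]

lemma eval_smul_homog {f : MvPolynomial J K} {d : ℕ} (hf : f.IsHomogeneous d) (c : K) (v : J → K) :
    MvPolynomial.eval (c • v) f = c ^ d * MvPolynomial.eval v f := by
  rw [MvPolynomial.eval_eq', MvPolynomial.eval_eq', Finset.mul_sum]
  refine Finset.sum_congr rfl fun e he => ?_
  have h1 : ∑ i, e i = d := by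
    have := hf (MvPolynomial.mem_support_iff.1 he)
    rw [Finsupp.weight_apply, Finsupp.sum_fintype _ _ (by simp)] at this
    simpa using this
  simp only [Pi.smul_apply, smul_eq_mul, mul_pow, Finset.prod_mul_distrib, Finset.prod_pow_eq_pow_sum,
    h1]
  ring

lemma homog_comp_zero [Infinite K] {f : MvPolynomial J K} (v : J → K)
    (h : ∀ c : K, c ≠ 0 → MvPolynomial.eval (c • v) f = 0) (d : ℕ) :
    MvPolynomial.eval v (MvPolynomial.homogeneousComponent d f) = 0 := by
  let p : Polynomial K := ∑ i ∈ Finset.range (f.totalDegree + 1),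
    Polynomial.monomial i (MvPolynomial.eval v (MvPolynomial.homogeneousComponent i f))
  have hp : p = 0 := by
    suffices hX : Polynomial.X * p = 0 from (mul_eq_zero.1 hX).resolve_left Polynomial.X_ne_zero
    apply Polynomial.funext
    intro c
    rw [Polynomial.eval_zero, Polynomial.eval_mul, Polynomial.eval_X]
    by_cases hc : c = 0
    · rw [hc, zero_mul]
    rw [mul_eq_zero]
    right
    rw [← h c hc]
    conv_rhs => rw [← MvPolynomial.sum_homogeneousComponent f, map_sum]
    rw [Polynomial.eval_finset_sum]
    refine Finset.sum_congr rfl fun i _ => ?_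
    rw [Polynomial.eval_monomial,
      eval_smul_homog (MvPolynomial.homogeneousComponent_isHomogeneous i f), mul_comm]
  by_cases hd : d < f.totalDegree + 1
  · have := congrArg (fun p => Polynomial.coeff p d) hp
    simp only [p, Polynomial.finset_sum_coeff, Polynomial.coeff_monomial, Polynomial.coeff_zero,
      Finset.sum_ite_eq', Finset.mem_range, hd, if_true] at this
    exact this
  · rw [MvPolynomial.homogeneousComponent_eq_zero _ _ (by omega), map_zero]

def VI (Y : Set (PP K J)) : Ideal (MvPolynomial J K) where
  carrier := {f | ∀ x ∈ Y, ∀ v ∈ x.submodule, MvPolynomial.eval v f = 0}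
  add_mem' := by
    intro f g hf hg x hx v hv
    rw [map_add, hf x hx v hv, hg x hx v hv, add_zero]
  zero_mem' := by
    intro x hx v hv
    rw [map_zero]
  smul_mem' := by
    intro c f hf x hx v hv
    rw [smul_eq_mul, map_mul, hf x hx v hv, mul_zero]

lemma mem_VI {Y : Set (PP K J)} {f : MvPolynomial J K} :
    f ∈ VI Y ↔ ∀ x ∈ Y, ∀ v ∈ x.submodule, MvPolynomial.eval v f = 0 := Iff.rfl

lemma VI_comp [Infinite K] {Y : Set (PP K J)} {f : MvPolynomial J K} (hf : f ∈ VI Y) (d : ℕ) :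
    MvPolynomial.homogeneousComponent d f ∈ VI Y := by
  intro x hx v hv
  apply homog_comp_zero
  intro c _
  exact hf x hx _ (Submodule.smul_mem _ c hv)

lemma isZClosed_zeroLocus {f : MvPolynomial J K} {d : ℕ} (hf : f.IsHomogeneous d) :
    IsZClosed (zeroLocus ({f} : Set (MvPolynomial J K))) :=
  ⟨{f}, by rintro g rfl; exact ⟨d, hf⟩, rfl⟩

lemma mem_zeroLocus_of_rep {f : MvPolynomial J K} {d : ℕ} (hf : f.IsHomogeneous d) (x : PP K J)
    (v : J → K) (hv : v ∈ x.submodule) (hv0 : v ≠ 0)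
    (h : MvPolynomial.eval v f = 0) : x ∈ zeroLocus ({f} : Set (MvPolynomial J K)) := by
  rintro g rfl w hw
  have h1 : x.submodule = Submodule.span K {x.rep} := Projectivization.submodule_eq x
  rw [h1, Submodule.mem_span_singleton] at hv hw
  obtain ⟨a, rfl⟩ := hv
  obtain ⟨b, rfl⟩ := hw
  have ha : a ≠ 0 := by
    rintro rfl
    simp at hv0
  have : b • x.rep = (b / a) • (a • x.rep) := by
    rw [smul_smul, div_mul_cancel₀ _ ha]
  rw [this, eval_smul_homog hf, h, mul_zero]

lemma VI_prime [Infinite K] {Y : Set (PP K J)} (hY : IsZIrreducible Y) : (VI Y).IsPrime := by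
  classical
  letI := MvPolynomial.gradedAlgebra (σ := J) (R := K)
  refine Ideal.IsHomogeneous.isPrime_of_homogeneous_mem_or_mem
    (𝒜 := MvPolynomial.homogeneousSubmodule J K) ?_ ?_ ?_
  · intro i f hf
    have := VI_comp hf i
    have h2 := MvPolynomial.decomposition.decompose'_apply f i
    rw [← h2] at this
    exact this
  · intro h
    obtain ⟨x, hx⟩ := hY.1
    have h1 : (1 : MvPolynomial J K) ∈ VI Y := by rw [h]; trivial
    have := h1 x hx 0 (Submodule.zero_mem _)
    simp at this
  · rintro f g ⟨a, ha⟩ ⟨b, hb⟩ hfg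
    have ha' : f.IsHomogeneous a := ha
    have hb' : g.IsHomogeneous b := hb
    have := hY.2 _ _ (isZClosed_zeroLocus ha') (isZClosed_zeroLocus hb') ?_
    · rcases this with h | h
      · left
        intro x hx v hv
        exact h hx f rfl v hv
      · right
        intro x hx v hv
        exact h hx g rfl v hv
    · intro x hx
      have hr : x.rep ∈ x.submodule := by
        rw [Projectivization.submodule_eq]; exact Submodule.mem_span_singleton_self _
      have := hfg x hx x.rep hr
      rw [map_mul, mul_eq_zero] at this
      rcases this with h | h
      · exact Or.inl (mem_zeroLocus_of_rep ha' x _ hr x.rep_nonzero h)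
      · exact Or.inr (mem_zeroLocus_of_rep hb' x _ hr x.rep_nonzero h)

lemma VI_lt {Y Z : Set (PP K J)} (hY : IsZClosed Y) (h : Y < Z) : VI Z < VI Y := by
  refine lt_of_le_not_ge (fun f hf x hx => hf x (h.1 hx)) ?_
  intro hle
  apply h.2
  obtain ⟨S, hS, rfl⟩ := hY
  intro x hx f hf
  refine hle (x := f) ?_ x hx
  intro y hy
  exact hy f hf

def irr (K : Type*) [Field K] (J : Type*) : Ideal (MvPolynomial J K) :=
  RingHom.ker (MvPolynomial.eval (0 : J → K))

lemma VI_lt_irr {Y : Set (PP K J)} (hY : Y.Nonempty) : VI Y < irr K J := by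
  obtain ⟨x, hx⟩ := hY
  refine lt_of_le_not_ge ?_ ?_
  · intro f hf
    exact hf x hx 0 (Submodule.zero_mem _)
  · intro hle
    apply x.rep_nonzero
    funext i
    have h1 : (MvPolynomial.X i : MvPolynomial J K) ∈ irr K J := by
      simp [irr, RingHom.mem_ker]
    have := hle h1 x hx x.rep (by
      rw [Projectivization.submodule_eq]; exact Submodule.mem_span_singleton_self _)
    simpa using this

lemma dim_gen [Infinite K] (S : Set (PP K J)) (I : Ideal (MvPolynomial J K)) (hI : I ≠ ⊤)
    (hIS : I ≤ VI S) (hS : S.Nonempty) (d : ℕ) (hd : zdim S = ((d : ℕ∞) : WithBot ℕ∞)) :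
    ∃ F : Fin (d + 1) → MvPolynomial J K, ∀ f : MvPolynomial (Fin (d + 1)) K,
      MvPolynomial.aeval F f ∈ I → f = 0 := by
  set α := {Y : Set (PP K J) // IsZClosed Y ∧ IsZIrreducible Y ∧ Y ⊆ zclosure S} with hα
  have hS' : I ≤ VI (zclosure S) := by
    intro f hf x hx v hv
    have h0 : f = ∑ i ∈ Finset.range (f.totalDegree + 1), MvPolynomial.homogeneousComponent i f :=
      (MvPolynomial.sum_homogeneousComponent f).symm
    rw [h0, map_sum]
    refine Finset.sum_eq_zero fun i _ => ?_
    have h1 := VI_comp (hIS hf) i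
    have h2 : x ∈ zeroLocus {MvPolynomial.homogeneousComponent i f} := by
      refine hx _ ⟨isZClosed_zeroLocus (MvPolynomial.homogeneousComponent_isHomogeneous i f), ?_⟩
      intro y hy g hg
      rw [Set.mem_singleton_iff] at hg
      rw [hg]
      exact h1 y hy
    exact h2 _ rfl v hv
  haveI : Nonempty α := by
    by_contra hne
    rw [not_nonempty_iff] at hne
    have : zdim S = ⊥ := Order.krullDim_eq_bot_iff.2 hne
    rw [hd] at this
    exact WithBot.coe_ne_bot this
  let φ : WithBot α → Ideal (MvPolynomial J K) := fun x =>
    WithBot.recBotCoe (C := fun _ => Ideal (MvPolynomial J K)) (irr K J) (fun Y => VI Y.1) x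
  refine noether_gen (γ := WithBot α) I hI φ ?_ ?_ ?_ (d + 1) ?_
  · intro x
    induction x using WithBot.recBotCoe with
    | bot => exact RingHom.ker_isPrime _
    | coe Y => exact VI_prime Y.2.2.1
  · intro x
    induction x using WithBot.recBotCoe with
    | bot =>
      obtain ⟨x, hx⟩ := hS
      exact fun f hf => hIS hf x hx 0 (Submodule.zero_mem _)
    | coe Y =>
      intro f hf x hx
      exact hS' hf x (Y.2.2.2 hx)
  · intro x y hxy
    induction y using WithBot.recBotCoe with
    | bot => exact absurd hxy not_lt_bot
    | coe Y =>
      induction x using WithBot.recBotCoe with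
      | bot => exact VI_lt_irr Y.2.2.1.1
      | coe X => 
        have h1 : X < Y := WithBot.coe_lt_coe.1 hxy
        exact VI_lt X.2.1 h1
  · rw [Order.krullDim_withBot]
    have : Order.krullDim α = ((d : ℕ∞) : WithBot ℕ∞) := hd
    rw [this]
    push_cast
    exact le_rfl

end vanish

section segre
open Function
variable {s : ℕ} {n : Fin s → ℕ}
variable {K : Type*} [Field K]

abbrev Par (n : Fin s → ℕ) (j : ℕ) : Type := Fin j × (Σ i, Fin (n i + 1))

def gu (K : Type*) [Field K] (n : Fin s → ℕ) (j : ℕ) (l : Fin j) (i : Fin s) (x : Fin (n i + 1)) :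
    MvPolynomial (Par n j) K := MvPolynomial.X (l, ⟨i, x⟩)

def theta (K : Type*) [Field K] (n : Fin s → ℕ) (j : ℕ) :
    MvPolynomial (Idx n) K →ₐ[K] MvPolynomial (Par n j) K :=
  MvPolynomial.aeval (∑ l, rk1 (gu K n j l))

lemma sum_rk1_map {R R' : Type*} [CommRing R] [CommRing R'] (φ : R →+* R') {L : Type*} [Fintype L]
    (u : L → ∀ i, Fin (n i + 1) → R) (t : Idx n) :
    φ ((∑ l, rk1 (u l)) t) = (∑ l, rk1 (fun i x => φ (u l i x))) t := by
  simp [Finset.sum_apply, rk1, map_sum, map_prod]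

lemma theta_aeval {R : Type*} [CommRing R] [Algebra K R] {j : ℕ} (u : Fin j → ∀ i, Fin (n i + 1) → R)
    (f : MvPolynomial (Idx n) K) :
    MvPolynomial.aeval (fun p : Par n j => u p.1 p.2.1 p.2.2) (theta K n j f) =
      MvPolynomial.aeval (∑ l, rk1 (u l)) f := by
  rw [← AlgHom.comp_apply]
  congr 1
  apply MvPolynomial.algHom_ext
  intro t
  rw [AlgHom.comp_apply, theta, MvPolynomial.aeval_X, MvPolynomial.aeval_X]
  have := sum_rk1_map (MvPolynomial.aeval (fun p : Par n j => u p.1 p.2.1 p.2.2) :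
    MvPolynomial (Par n j) K →ₐ[K] R).toRingHom (gu K n j) t
  refine this.trans ?_
  simp [gu]

lemma theta_zero_iff [Infinite K] {j : ℕ} (f : MvPolynomial (Idx n) K) :
    theta K n j f = 0 ↔ ∀ u : Fin j → ∀ i, Fin (n i + 1) → K,
      MvPolynomial.eval (∑ l, rk1 (u l)) f = 0 := by
  constructor
  · intro h u
    have := theta_aeval u f
    rw [h, map_zero] at this
    rw [← MvPolynomial.coe_aeval_eq_eval]
    exact this.symm
  · intro h
    apply MvPolynomial.funext
    intro w
    rw [map_zero]
    have h1 := theta_aeval (fun l i x => w (l, ⟨i, x⟩)) f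
    have h2 := h (fun l i x => w (l, ⟨i, x⟩))
    rw [← MvPolynomial.coe_aeval_eq_eval] at h2 ⊢
    exact h1.trans h2

lemma exists_smul_rk1 {A : Type*} [Field A] (i0 : Fin s) (c : A) (u : ∀ i, Fin (n i + 1) → A) :
    ∃ u' : ∀ i, Fin (n i + 1) → A, rk1 u' = c • rk1 u := by
  refine ⟨fun i => (if i = i0 then c else 1) • u i, ?_⟩
  rw [rk1_smul]
  simp

lemma theta_comp [Infinite K] (i0 : Fin s) {j : ℕ} {f : MvPolynomial (Idx n) K}
    (hf : theta K n j f = 0) (d : ℕ) :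
    theta K n j (MvPolynomial.homogeneousComponent d f) = 0 := by
  rw [theta_zero_iff] at hf ⊢
  intro u
  apply homog_comp_zero
  intro c _
  choose u' hu' using fun l => exists_smul_rk1 i0 c (u l)
  have := hf u'
  simp only [hu'] at this
  rw [← Finset.smul_sum] at this
  exact this

lemma mk_mem_segre (u : ∀ i, Fin (n i + 1) → K) (h : rk1 u ≠ 0) :
    Projectivization.mk K (rk1 u) h ∈ segreVariety K s n :=
  ⟨u, Projectivization.submodule_mk _ _⟩

lemma segre_vec (i0 : Fin s) {x : PP K (Idx n)} (hx : x ∈ segreVariety K s n) {v : Idx n → K}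
    (hv : v ∈ x.submodule) : ∃ u : ∀ i, Fin (n i + 1) → K, rk1 u = v := by
  obtain ⟨u, hu⟩ := hx
  rw [hu, Submodule.mem_span_singleton] at hv
  obtain ⟨c, rfl⟩ := hv
  exact exists_smul_rk1 i0 c u

lemma GG_none_zero {A : Type*} [CommRing A] (a : Dlt n → A) : GG a none 0 = 1 := by
  rw [GG_none]
  simp [VV, rk1, chartVec_zero]

lemma GG_none_update {A : Type*} [CommRing A] (a : Dlt n → A) (d : Dlt n) :
    GG a none (update 0 d.1 d.2.succ) = a d := by
  rw [GG_none]
  simp only [VV, rk1]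
  rw [Finset.prod_eq_single d.1]
  · simp [chartVec_zero]
  · intro i _ hi
    simp [chartVec_zero, update_of_ne hi]
  · simp

lemma segre_infinite [Infinite K] (d0 : Dlt n) : Infinite (segreVariety K s n) := by
  let g : K → segreVariety K s n := fun c =>
    ⟨Projectivization.mk K (GG (fun _ => c) none) (fun h => by
      have := congrFun h 0
      rw [GG_none_zero] at this
      exact one_ne_zero this), mk_mem_segre _ _⟩
  refine Infinite.of_injective g ?_
  intro a b hab
  have h1 := congrArg Subtype.val hab
  simp only [g] at h1
  rw [Projectivization.mk_eq_mk_iff'] at h1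
  obtain ⟨c, hc⟩ := h1
  have h2 := congrFun hc 0
  have h3 := congrFun hc (update 0 d0.1 d0.2.succ)
  simp only [Pi.smul_apply, GG_none_zero, GG_none_update, smul_eq_mul, mul_one] at h2 h3
  rw [h2, one_mul] at h3
  exact h3.symm

lemma mem_base [Infinite K] (d0 : Dlt n) {j : ℕ} (u : Fin j → ∀ i, Fin (n i + 1) → K) (v : Idx n → K)
    (hv : v = ∑ l, rk1 (u l)) (hv0 : v ≠ 0) :
    ∃ S : Finset (PP K (Idx n)), ↑S ⊆ segreVariety K s n ∧ S.card = j ∧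
      Projectivization.mk K v hv0 ∈ projSpan (S : Set (PP K (Idx n))) := by
  classical
  haveI := segre_infinite (K := K) d0
  obtain ⟨x0⟩ : Nonempty (segreVariety K s n) := inferInstance
  let g : Fin j → segreVariety K s n := fun l =>
    if h : rk1 (u l) ≠ 0 then ⟨Projectivization.mk K (rk1 (u l)) h, mk_mem_segre _ _⟩ else x0
  obtain ⟨T, hT, hTc⟩ := Infinite.exists_superset_card_eq (Finset.univ.image g) j
    (Finset.card_image_le.trans (by simp))
  refine ⟨T.map (Embedding.subtype _), ?_, ?_, ?_⟩
  · intro x hx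
    simp only [Finset.coe_map, Set.mem_image] at hx
    obtain ⟨y, -, rfl⟩ := hx
    exact y.2
  · rw [Finset.card_map, hTc]
  · rw [projSpan, Set.mem_setOf_eq, Projectivization.submodule_mk, Submodule.span_singleton_le_iff_mem,
      hv]
    refine Submodule.sum_mem _ fun l _ => ?_
    by_cases h : rk1 (u l) = 0
    · rw [h]; exact Submodule.zero_mem _
    · apply Submodule.subset_span
      simp only [coneOf, Set.mem_iUnion]
      refine ⟨(g l).1, ?_, ?_⟩
      · simp only [Finset.coe_map, Set.mem_image]
        exact ⟨g l, hT (Finset.mem_image_of_mem _ (Finset.mem_univ _)), rfl⟩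
      · simp only [g, dif_pos h, SetLike.mem_coe]
        rw [Projectivization.submodule_mk]
        exact Submodule.mem_span_singleton_self _

lemma vspan_sum (S : Finset (PP K (Idx n))) (v : Idx n → K)
    (hv : v ∈ vspan (S : Set (PP K (Idx n)))) :
    ∃ w : S → Idx n → K, (∀ p, w p ∈ p.1.submodule) ∧ v = ∑ p, w p := by
  have h1 : vspan (S : Set (PP K (Idx n))) = ⨆ p : S, p.1.submodule := by
    rw [vspan, coneOf, Submodule.span_iUnion₂]
    simp only [Submodule.span_eq]
    rw [iSup_subtype']
    rfl
  rw [h1, Submodule.mem_iSup_iff_exists_finsupp] at hv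
  obtain ⟨f, hf, rfl⟩ := hv
  refine ⟨fun p => f p, hf, ?_⟩
  rw [Finsupp.sum_fintype _ _ (by simp)]

lemma exists_params (i0 : Fin s) {j : ℕ} (S : Finset (PP K (Idx n))) (hS : ↑S ⊆ segreVariety K s n)
    (e : S ↪ Fin j) (v : Idx n → K) (hv : v ∈ vspan (S : Set (PP K (Idx n)))) :
    ∃ u : Fin j → ∀ i, Fin (n i + 1) → K, v = ∑ l, rk1 (u l) ∧
      (∀ p : S, rk1 (u (e p)) ∈ p.1.submodule) ∧
      (∀ l, rk1 (u l) = 0 ∨ ∃ p ∈ S, rk1 (u l) ∈ p.submodule) := by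
  classical
  obtain ⟨w, hw, rfl⟩ := vspan_sum S v hv
  choose u hu using fun p : S => segre_vec i0 (hS p.2) (hw p)
  have hz : rk1 (fun i => (0 : Fin (n i + 1) → K)) = 0 := by
    funext t
    simp only [rk1, Pi.zero_apply]
    exact Finset.prod_eq_zero (Finset.mem_univ i0) rfl
  let U : Fin j → ∀ i, Fin (n i + 1) → K := fun l =>
    if h : ∃ p, e p = l then u h.choose else fun i => 0
  have hU : ∀ p, U (e p) = u p := by
    intro p
    have h : ∃ p', e p' = e p := ⟨p, rfl⟩
    simp only [U, dif_pos h]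
    rw [e.injective h.choose_spec]
  have hU' : ∀ l, (¬ ∃ p, e p = l) → rk1 (U l) = 0 := by
    intro l h
    simp only [U, dif_neg h]
    exact hz
  refine ⟨U, ?_, ?_, ?_⟩
  · have h1 : ∑ p, w p = ∑ p, rk1 (U (e p)) := by simp only [hU, hu]
    rw [h1, ← Finset.sum_map Finset.univ e (fun l => rk1 (U l))]
    refine Finset.sum_subset (Finset.subset_univ _) ?_
    intro l _ hl
    apply hU'
    rintro ⟨p, rfl⟩
    exact hl (Finset.mem_map_of_mem _ (Finset.mem_univ _))
  · intro p
    rw [hU, hu]; exact hw p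
  · intro l
    by_cases h : ∃ p, e p = l
    · obtain ⟨p, rfl⟩ := h
      right
      exact ⟨p.1, p.2, by rw [hU, hu]; exact hw p⟩
    · exact Or.inl (hU' l h)

lemma theta_VI [Infinite K] (i0 : Fin s) {j : ℕ} {f : MvPolynomial (Idx n) K}
    (hf : theta K n j f = 0) : f ∈ VI (secant j (segreVariety K s n)) := by
  intro x hx v hv
  have h0 : f = ∑ i ∈ Finset.range (f.totalDegree + 1), MvPolynomial.homogeneousComponent i f :=
    (MvPolynomial.sum_homogeneousComponent f).symm
  rw [h0, map_sum]
  refine Finset.sum_eq_zero fun d _ => ?_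
  have h2 : x ∈ zeroLocus {MvPolynomial.homogeneousComponent d f} := by
    refine hx _ ⟨isZClosed_zeroLocus (MvPolynomial.homogeneousComponent_isHomogeneous d f), ?_⟩
    rintro y ⟨S, hS, hSc, hy⟩ g hg w hw
    rw [Set.mem_singleton_iff] at hg
    rw [hg]
    obtain ⟨u, hu, -⟩ := exists_params i0 S hS (S.equivFinOfCardEq hSc).toEmbedding w (hy hw)
    rw [hu]
    exact (theta_zero_iff _).1 (theta_comp i0 hf d) u
  exact h2 _ rfl v hv

lemma subset_zclosure (S : Set (PP K (Idx n))) : S ⊆ zclosure S := by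
  intro x hx Y hY
  exact hY.2 hx

lemma secant_nonempty [Infinite K] (d0 : Dlt n) (j : ℕ) (hj : 1 ≤ j) :
    (secant j (segreVariety K s n)).Nonempty := by
  classical
  haveI := segre_infinite (K := K) d0
  obtain ⟨x0⟩ : Nonempty (segreVariety K s n) := inferInstance
  obtain ⟨T, hT, hTc⟩ := Infinite.exists_superset_card_eq ({x0} : Finset (segreVariety K s n)) j (by simpa using hj)
  refine ⟨x0.1, subset_zclosure _ ⟨T.map (Embedding.subtype _), ?_, ?_, ?_⟩⟩
  · intro x hx
    simp only [Finset.coe_map, Set.mem_image] at hx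
    obtain ⟨y, -, rfl⟩ := hx
    exact y.2
  · rw [Finset.card_map, hTc]
  · intro v hv
    apply Submodule.subset_span
    simp only [coneOf, Set.mem_iUnion]
    refine ⟨x0.1, ?_, hv⟩
    simp only [Finset.coe_map, Set.mem_image]
    exact ⟨x0, hT (by simp), rfl⟩

lemma VI_theta [Infinite K] (d0 : Dlt n) {j : ℕ} (hj : 1 ≤ j) {f : MvPolynomial (Idx n) K}
    (hf : f ∈ VI (secant j (segreVariety K s n))) : theta K n j f = 0 := by
  rw [theta_zero_iff]
  intro u
  by_cases h : (∑ l, rk1 (u l)) = 0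
  · obtain ⟨x, hx⟩ := secant_nonempty (K := K) d0 j hj
    rw [h]
    exact hf x hx 0 (Submodule.zero_mem _)
  · refine hf (Projectivization.mk K _ h) (subset_zclosure _ (mem_base d0 u _ rfl h)) _ ?_
    rw [Projectivization.submodule_mk]
    exact Submodule.mem_span_singleton_self _

end segre

section sub
open Function
variable {s : ℕ} {n : Fin s → ℕ}
variable {K : Type*} [Field K] [CharZero K]
variable {L : Type*} [Fintype L]
variable {A : Type*} [Field A] [Algebra K A]

lemma gen_of_alg {J Y : Type*} [Finite J] [Fintype Y] (q : J → A) (y : Y → A)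
    (hy : AlgebraicIndependent K y)
    (h : ∀ i, IsAlgebraic (Algebra.adjoin K (Set.range q)) (y i)) : Gen K q (Fintype.card Y) := by
  classical
  obtain ⟨T, hT⟩ := (AlgebraicIndependent.matroid K A).exists_isBasis (Set.range q)
  have hyi : (AlgebraicIndependent.matroid K A).Indep (Set.range y) := by
    rw [AlgebraicIndependent.matroid_indep_iff]
    exact hy.to_subtype_range
  have hsub : Set.range y ⊆ (AlgebraicIndependent.matroid K A).closure (Set.range q) := by
    rw [AlgebraicIndependent.matroid_closure_eq]
    rintro _ ⟨i, rfl⟩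
    exact h i
  have h1 := hyi.encard_le_eRk_of_subset hsub
  rw [Matroid.eRk_closure_eq, ← hT.encard_eq_eRk] at h1
  have hTq : T ⊆ Set.range q := hT.subset
  have hTfin : T.Finite := (Set.finite_range q).subset hTq
  have h2 : (Set.range y).encard = Fintype.card Y := by
    rw [← Set.image_univ, hy.injective.encard_image, Set.encard_univ]
    simp
  haveI := hTfin.fintype
  rw [h2, Set.encard_eq_coe_toFinset_card] at h1
  have h3 : Fintype.card (Fin (Fintype.card Y)) ≤ Fintype.card T := by
    rw [Fintype.card_fin, ← Set.toFinset_card]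
    exact_mod_cast h1
  obtain ⟨e⟩ := Function.Embedding.nonempty_of_card_le h3
  choose t ht using fun x : T => hTq x.2
  refine ⟨fun c => MvPolynomial.X (t (e c)), ?_⟩
  have h4 : AlgebraicIndependent K (fun x : T => (x : A)) :=
    AlgebraicIndependent.matroid_indep_iff.1 hT.indep
  have h5 := h4.comp e e.injective
  convert h5 using 1
  funext c
  simp only [MvPolynomial.aeval_X, ht, Function.comp]

lemma gen_of_LI (z : L → Option (Dlt n) → A) (hz : AlgebraicIndependent K (zf z))
    (hLI : LinearIndependent A (GF (ch z))) : Gen K (Phi z) (Fintype.card L * (∑ i, n i + 1)) := by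
  rw [← card_flat]
  refine gen_of_alg (Phi z) (zf z) hz ?_
  intro x
  by_contra hx
  let F0 := IntermediateField.adjoin K (Set.range (Phi z))
  have htr : Transcendental F0 (zf z x) := by
    intro h
    apply hx
    exact IntermediateField.isAlgebraic_adjoin_iff.1 h
  have hind : AlgebraicIndependent F0 (fun _ : Unit => zf z x) :=
    (algebraicIndependent_unique_type_iff).2 htr
  obtain ⟨D', hD'⟩ := exists_deriv hind (fun _ => 1)
  let D : Derivation K A A := D'.restrictScalars K
  have hD : D (zf z x) = 1 := hD' ()
  have h0 : Dv D (Phi z) = 0 := by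
    funext t
    have : Phi z t = algebraMap F0 A ⟨Phi z t, IntermediateField.subset_adjoin _ _ ⟨t, rfl⟩⟩ := rfl
    change D' (Phi z t) = 0
    rw [this]
    exact D'.map_algebraMap _
  rw [Dv_Phi] at h0
  have h1 := Fintype.linearIndependent_iff.1 hLI _ h0 x
  obtain ⟨l, _ | d⟩ := x
  · simp only [dcoef] at h1
    simp only [zf] at hD
    rw [hD] at h1
    exact one_ne_zero h1
  · simp only [dcoef] at h1
    simp only [zf] at hD
    rw [hD, mul_one] at h1
    exact hz.ne_zero (l, none) h1

end sub

section gendim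
open Function
variable {s : ℕ} {n : Fin s → ℕ}
variable {K : Type*} [Field K]

abbrev AH (K : Type*) [Field K] (n : Fin s → ℕ) (m : ℕ) : Type _ :=
  FractionRing (MvPolynomial (Par n m) K)

def uh (K : Type*) [Field K] (n : Fin s → ℕ) (m : ℕ) (l : Fin m) (i : Fin s) (x : Fin (n i + 1)) :
    AH K n m := algebraMap (MvPolynomial (Par n m) K) (AH K n m) (MvPolynomial.X (l, ⟨i, x⟩))

lemma uh_aeval (m : ℕ) (f : MvPolynomial (Idx n) K) :
    MvPolynomial.aeval (∑ l, rk1 (uh K n m l)) f =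
      algebraMap (MvPolynomial (Par n m) K) (AH K n m) (theta K n m f) := by
  rw [← theta_aeval]
  have : (MvPolynomial.aeval (fun p : Par n m => uh K n m p.1 p.2.1 p.2.2) :
      MvPolynomial (Par n m) K →ₐ[K] AH K n m) = IsScalarTower.toAlgHom K _ _ := by
    apply MvPolynomial.algHom_ext
    intro p
    rw [MvPolynomial.aeval_X]
    rfl
  rw [this]
  rfl

lemma uh_indep (m : ℕ) : AlgebraicIndependent K (fun p : Par n m => uh K n m p.1 p.2.1 p.2.2) := by
  have h : AlgebraicIndependent K (MvPolynomial.X : Par n m → MvPolynomial (Par n m) K) :=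
    MvPolynomial.algebraicIndependent_X _ _
  exact h.map' (f := IsScalarTower.toAlgHom K (MvPolynomial (Par n m) K) (AH K n m))
    (IsFractionRing.injective _ _)

lemma gen_of_dim [Infinite K] (d0 : Dlt n) (m : ℕ) (hm : 1 ≤ m)
    (h : zdim (secant m (segreVariety K s n)) =
      (((m * (∑ i, n i + 1) - 1 : ℕ) : ℕ∞) : WithBot ℕ∞)) :
    Gen K (∑ l, rk1 (uh K n m l)) (m * (∑ i, n i + 1)) := by
  obtain ⟨F, hF⟩ := dim_gen (secant m (segreVariety K s n)) (RingHom.ker (theta K n m))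
    (RingHom.ker_ne_top _) (fun f hf => theta_VI d0.1 hf) (secant_nonempty d0 m hm) _ h
  have hpos : 0 < m * (∑ i, n i + 1) := by positivity
  have he : m * (∑ i, n i + 1) - 1 + 1 = m * (∑ i, n i + 1) := by omega
  rw [← he]
  refine ⟨F, ?_⟩
  simp only [uh_aeval]
  rw [algebraicIndependent_iff]
  intro p hp
  apply hF
  rw [RingHom.mem_ker]
  apply IsFractionRing.injective (MvPolynomial (Par n m) K) (AH K n m)
  rw [map_zero, ← hp]
  have h2 : (IsScalarTower.toAlgHom K (MvPolynomial (Par n m) K) (AH K n m)).comp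
      ((theta K n m).comp (MvPolynomial.aeval F)) =
      MvPolynomial.aeval (fun c => algebraMap (MvPolynomial (Par n m) K) (AH K n m)
        (theta K n m (F c))) := by
    apply MvPolynomial.algHom_ext
    intro c
    simp
  rw [← h2]
  rfl

end gendim

section lift
open Function
variable {s : ℕ} {n : Fin s → ℕ}
variable {K : Type*} [Field K]

lemma gen_transfer {A A' J : Type*} [Field A] [Algebra K A] [Field A'] [Algebra K A'] (q : J → A)
    (q' : J → A') (h : ∀ f : MvPolynomial J K, MvPolynomial.aeval q' f = 0 → MvPolynomial.aeval q f = 0)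
    (d : ℕ) (hg : Gen K q d) : Gen K q' d := by
  obtain ⟨F, hF⟩ := hg
  refine ⟨F, ?_⟩
  rw [algebraicIndependent_iff] at hF ⊢
  have key : ∀ {B : Type _} [Field B] [Algebra K B] (r : J → B) (p : MvPolynomial (Fin d) K),
      MvPolynomial.aeval (fun c => MvPolynomial.aeval r (F c)) p =
        MvPolynomial.aeval r (MvPolynomial.aeval F p) := by
    intro B _ _ r p
    rw [← AlgHom.comp_apply, MvPolynomial.comp_aeval]
  have key' : ∀ {B : Type _} [Field B] [Algebra K B] (r : J → B) (p : MvPolynomial (Fin d) K),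
      MvPolynomial.aeval (fun c => MvPolynomial.aeval r (F c)) p =
        MvPolynomial.aeval r (MvPolynomial.aeval F p) := by
    intro B _ _ r p
    rw [← AlgHom.comp_apply, MvPolynomial.comp_aeval]
  intro p hp
  apply hF
  rw [key'] at hp
  rw [key]
  exact h _ hp

lemma exists_lift {A A' J Y : Type*} [Field A] [Algebra K A] [Field A'] [Algebra K A'] [IsAlgClosed A']
    (q : J → A) (q' : J → A')
    (h : ∀ f : MvPolynomial J K, MvPolynomial.aeval q' f = 0 ↔ MvPolynomial.aeval q f = 0)
    (y : Y → A) (hy : ∀ i, IsAlgebraic (Algebra.adjoin K (Set.range q)) (y i)) :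
    ∃ (S : Subring A) (g : S →+* A'), (∀ i, y i ∈ S) ∧
      ∀ t, ∃ ht : q t ∈ S, g ⟨q t, ht⟩ = q' t := by
  let B := Algebra.adjoin K (Set.range q)
  let q0 : J → B := fun t => ⟨q t, Algebra.subset_adjoin ⟨t, rfl⟩⟩
  have hq0 : ∀ f : MvPolynomial J K, ((MvPolynomial.aeval q0 f : B) : A) = MvPolynomial.aeval q f := by
    intro f
    change B.val (MvPolynomial.aeval q0 f) = _
    rw [← AlgHom.comp_apply, MvPolynomial.comp_aeval]
    rfl
  have hsurj : Function.Surjective (MvPolynomial.aeval q0 : MvPolynomial J K →ₐ[K] B) := by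
    rintro ⟨b, hb⟩
    have hb' : b ∈ Algebra.adjoin K (Set.range q) := hb
    rw [Algebra.adjoin_range_eq_range_aeval] at hb'
    obtain ⟨f, hf⟩ := hb'
    exact ⟨f, Subtype.ext ((hq0 f).trans hf)⟩
  have hker : ∀ f : MvPolynomial J K, MvPolynomial.aeval q0 f = 0 ↔ MvPolynomial.aeval q' f = 0 := by
    intro f
    rw [h f, ← hq0]
    exact Subtype.ext_iff
  let φ : B →+* A' := RingHom.liftOfSurjective (MvPolynomial.aeval q0 : MvPolynomial J K →ₐ[K] B).toRingHom
    hsurj ⟨(MvPolynomial.aeval q' : MvPolynomial J K →ₐ[K] A').toRingHom, fun f hf => (hker f).1 hf⟩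
  have hφ : ∀ f : MvPolynomial J K, φ (MvPolynomial.aeval q0 f) = MvPolynomial.aeval q' f := by
    intro f
    exact RingHom.liftOfRightInverse_comp_apply _ _ _ _ f
  have hφinj : Function.Injective φ := by
    rw [injective_iff_map_eq_zero]
    intro b hb
    obtain ⟨f, rfl⟩ := hsurj b
    rw [hφ] at hb
    exact (hker f).2 hb
  letI : Algebra B A' := φ.toAlgebra
  haveI : FaithfulSMul B A' := (faithfulSMul_iff_algebraMap_injective B A').2 hφinj
  let S := Subalgebra.algebraicClosure B A
  let g : S →ₐ[B] A' := IsAlgClosed.lift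
  refine ⟨S.toSubring, g.toRingHom, fun i => hy i, fun t => ?_⟩
  have ht : q t ∈ S := isAlgebraic_algebraMap (q0 t)
  refine ⟨ht, ?_⟩
  have h1 : g (algebraMap B S (q0 t)) = φ (q0 t) := g.commutes (q0 t)
  have h2 := hφ (MvPolynomial.X t)
  rw [MvPolynomial.aeval_X, MvPolynomial.aeval_X] at h2
  exact h1.trans h2

lemma exists_lift_Phi {A A' L : Type*} [Fintype L] [Field A] [Algebra K A] [Field A'] [Algebra K A']
    [IsAlgClosed A'] (z : L → Option (Dlt n) → A) (q' : Idx n → A')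
    (h : ∀ f : MvPolynomial (Idx n) K, MvPolynomial.aeval q' f = 0 ↔ MvPolynomial.aeval (Phi z) f = 0)
    (hy : ∀ i, IsAlgebraic (Algebra.adjoin K (Set.range (Phi z))) (zf z i)) :
    ∃ x : L → Option (Dlt n) → A', q' = Phi x := by
  obtain ⟨S, g, hS, hg⟩ := exists_lift (Phi z) q' h (zf z) hy
  let y : L → Option (Dlt n) → S := fun l o => ⟨z l o, hS (l, o)⟩
  refine ⟨fun l o => g (y l o), ?_⟩
  funext t
  obtain ⟨ht, h1⟩ := hg t
  have h2 : (⟨Phi z t, ht⟩ : S) = ∑ l, y l none * GG (fun d => y l (some d)) none t := by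
    apply Subtype.ext
    change Phi z t = S.subtype _
    rw [map_sum]
    simp only [Phi, Finset.sum_apply, Pi.smul_apply, smul_eq_mul]
    refine Finset.sum_congr rfl fun l _ => ?_
    rw [map_mul, ← GG_map]
    rfl
  rw [← h1, h2, map_sum]
  simp only [Phi, Finset.sum_apply, Pi.smul_apply, smul_eq_mul]
  refine Finset.sum_congr rfl fun l _ => ?_
  rw [map_mul, ← GG_map]
  rfl

end lift

section germ
variable {J : Type*} (U : Ultrafilter J) {K : Type*} [Field K]

abbrev UG (U : Ultrafilter J) (K : Type*) [Field K] : Type _ := Filter.Germ (U : Filter J) K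

def ug : (J → K) →+* UG U K := Filter.Germ.coeRingHom (U : Filter J)

lemma ug_surj : Function.Surjective (ug U (K := K)) := by
  intro x
  induction x using Filter.Germ.inductionOn with
  | h f => exact ⟨f, rfl⟩

lemma ug_eq_iff (a b : J → K) : ug U a = ug U b ↔ ∀ᶠ g in (U : Filter J), a g = b g :=
  Filter.Germ.coe_eq

lemma ug_closed [IsAlgClosed K] : IsAlgClosed (UG U K) := by
  classical
  refine IsAlgClosed.of_exists_root _ ?_
  intro p hp hirr
  choose a ha using fun i => ug_surj U (p.coeff i)
  let d := p.natDegree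
  have hd : 0 < d := hirr.natDegree_pos
  let P : J → Polynomial K := fun g =>
    Polynomial.X ^ d + ∑ i : Fin d, Polynomial.C (a i g) * Polynomial.X ^ (i : ℕ)
  have hP : ∀ g, ∃ x, (P g).eval x = 0 := by
    intro g
    have h1 : (∑ i : Fin d, Polynomial.C (a i g) * Polynomial.X ^ (i : ℕ) : Polynomial K).degree <
        (d : WithBot ℕ) :=
      Polynomial.degree_sum_fin_lt _
    have h2 : (P g).degree = d := by
      rw [Polynomial.degree_add_eq_left_of_degree_lt]
      · exact Polynomial.degree_X_pow d
      · rw [Polynomial.degree_X_pow]; exact h1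
    have h3 : (P g).degree ≠ 0 := by
      rw [h2]
      exact_mod_cast hd.ne'
    exact IsAlgClosed.exists_root _ h3
  choose x hx using hP
  refine ⟨ug U x, ?_⟩
  rw [hp.as_sum]
  simp only [Polynomial.eval_add, Polynomial.eval_pow, Polynomial.eval_X, Polynomial.eval_finset_sum,
    Polynomial.eval_mul, Polynomial.eval_C]
  rw [Finset.sum_range (fun i => p.coeff i * ug U x ^ i)]
  simp only [← ha, ← map_pow, ← map_mul, ← map_sum, ← map_add]
  rw [← map_zero (ug U), ug_eq_iff]
  refine Filter.Eventually.of_forall fun g => ?_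
  have := hx g
  simp only [P, Polynomial.eval_add, Polynomial.eval_pow, Polynomial.eval_X, Polynomial.eval_finset_sum,
    Polynomial.eval_mul, Polynomial.eval_C] at this
  simp only [Pi.add_apply, Pi.pow_apply, Finset.sum_apply, Pi.mul_apply, Pi.zero_apply]
  exact this

@[reducible] def ugAlg : Algebra K (UG U K) := ((ug U).comp (Pi.constRingHom J K)).toAlgebra

lemma ug_aeval {I : Type*} (v : J → I → K) (f : MvPolynomial I K) :
    letI := ugAlg U (K := K)
    MvPolynomial.aeval (fun t => ug U (fun g => v g t)) f = ug U (fun g => MvPolynomial.eval (v g) f) := by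
  letI := ugAlg U (K := K)
  let ψ : MvPolynomial I K →+* (J → K) := Pi.ringHom fun g => MvPolynomial.eval (v g)
  have : (MvPolynomial.aeval (fun t => ug U (fun g => v g t)) : MvPolynomial I K →ₐ[K] UG U K).toRingHom
      = (ug U).comp ψ := by
    apply MvPolynomial.ringHom_ext
    · intro c
      change MvPolynomial.aeval _ (MvPolynomial.C c) = _
      rw [MvPolynomial.aeval_C]
      change ug U (Pi.constRingHom J K c) = ug U (ψ (MvPolynomial.C c))
      congr 1
      funext g
      exact (MvPolynomial.eval_C _).symm
    · intro t
      change MvPolynomial.aeval _ (MvPolynomial.X t) = _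
      rw [MvPolynomial.aeval_X]
      change ug U _ = ug U (ψ (MvPolynomial.X t))
      congr 1
      funext g
      exact (MvPolynomial.eval_X _).symm
  exact congrArg (fun h => h f) this

end germ

section stepone
open Function
variable {s : ℕ} {n : Fin s → ℕ}
variable {K : Type*} [Field K]

def Good {j : ℕ} (P Q : Fin j → ∀ i, Fin (n i + 1) → K) (l0 : Fin j) : Prop :=
  rk1 (P l0) ≠ 0 ∧ ∃ (l : Fin j) (c : K), rk1 (P l0) = c • rk1 (Q l)

def Bad {j : ℕ} (l0 : Fin j) (v : Idx n → K) : Prop :=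
  (∃ u : Fin j → ∀ i, Fin (n i + 1) → K, v = ∑ l, rk1 (u l)) →
    ∃ P Q : Fin j → ∀ i, Fin (n i + 1) → K, v = ∑ l, rk1 (P l) ∧ v = ∑ l, rk1 (Q l) ∧ ¬ Good P Q l0

lemma emb_to {α : Type*} [Fintype α] {j : ℕ} (h : Fintype.card α ≤ j) : Nonempty (α ↪ Fin j) :=
  Function.Embedding.nonempty_of_card_le (by simpa using h)

lemma emb_to_at {α : Type*} [Fintype α] {j : ℕ} (h : Fintype.card α ≤ j) (a : α) (l0 : Fin j) :
    ∃ e : α ↪ Fin j, e a = l0 := by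
  obtain ⟨e⟩ := emb_to (α := α) h
  refine ⟨e.trans (Equiv.swap (e a) l0).toEmbedding, ?_⟩
  simp

lemma bad_of_not_unique [Infinite K] (d0 : Dlt n) {j : ℕ} (l0 : Fin j) (v : Idx n → K) (hv0 : v ≠ 0)
    (hx : ¬ ∃! S : Finset (PP K (Idx n)),
      S ∈ decompositions (segreVariety K s n) (Projectivization.mk K v hv0)) : Bad l0 v := by
  classical
  rintro ⟨u, hu⟩
  set x := Projectivization.mk K v hv0 with hxdef
  obtain ⟨S, hS, hSc, hSx⟩ := mem_base d0 u v hu hv0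
  let T : Set ℕ := {k | ∃ S : Finset (PP K (Idx n)), ↑S ⊆ segreVariety K s n ∧ S.card = k ∧
    x ∈ projSpan (S : Set (PP K (Idx n)))}
  have hT : j ∈ T := ⟨S, hS, hSc, hSx⟩
  have hr : xrank (segreVariety K s n) x ≤ j := Nat.sInf_le hT
  obtain ⟨S1, h1a, h1b, h1c⟩ : xrank (segreVariety K s n) x ∈ T := Nat.sInf_mem ⟨j, hT⟩
  obtain ⟨S2, ⟨h2a, h2b, h2c⟩, hne⟩ : ∃ S2 : Finset (PP K (Idx n)),
      S2 ∈ decompositions (segreVariety K s n) x ∧ S2 ≠ S1 := by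
    by_contra hcon
    push Not at hcon
    exact hx ⟨S1, ⟨h1a, h1b, h1c⟩, hcon⟩
  obtain ⟨p, hp1, hp2⟩ : ∃ p ∈ S1, p ∉ S2 := by
    by_contra hcon
    push Not at hcon
    exact hne (Finset.eq_of_subset_of_card_le hcon (by rw [h1b, h2b])).symm
  obtain ⟨e1, he1⟩ := emb_to_at (α := S1) (j := j) (by simp [h1b, hr]) ⟨p, hp1⟩ l0
  obtain ⟨e2⟩ := emb_to (α := S2) (j := j) (by simp [h2b, hr])
  have hvx : v ∈ x.submodule := by
    rw [hxdef, Projectivization.submodule_mk]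
    exact Submodule.mem_span_singleton_self v
  obtain ⟨P, hP, hP1, -⟩ := exists_params d0.1 S1 h1a e1 v (h1c hvx)
  obtain ⟨Q, hQ, -, hQ2⟩ := exists_params d0.1 S2 h2a e2 v (h2c hvx)
  refine ⟨P, Q, hP, hQ, ?_⟩
  rintro ⟨hne0, l, c, hc⟩
  have hPp := hP1 ⟨p, hp1⟩
  rw [he1] at hPp
  rcases hQ2 l with h0 | ⟨p', hp', hq⟩
  · rw [h0, smul_zero] at hc
    exact hne0 hc
  · have hq' : rk1 (P l0) ∈ p'.submodule := by
      rw [hc]; exact Submodule.smul_mem _ _ hq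
    apply hp2
    have : p = p' := by
      have key : ∀ y : PP K (Idx n), rk1 (P l0) ∈ y.submodule →
          y = Projectivization.mk K (rk1 (P l0)) hne0 := by
        intro y hy
        rw [Projectivization.submodule_eq, Submodule.mem_span_singleton] at hy
        obtain ⟨a, ha⟩ := hy
        rw [← y.mk_rep, eq_comm, Projectivization.mk_eq_mk_iff']
        exact ⟨a, ha⟩
      rw [key p hPp, key p' hq']
    rw [this]; exact hp'

lemma step_one [Infinite K] (d0 : Dlt n) {j : ℕ} (hj : 1 ≤ j) (l0 : Fin j)
    (hni : ¬ Identifiable (segreVariety K s n) j) (f : MvPolynomial (Idx n) K)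
    (hf : theta K n j f ≠ 0) :
    ∃ v : Idx n → K, MvPolynomial.eval v f ≠ 0 ∧
      (∀ g, theta K n j g = 0 → MvPolynomial.eval v g = 0) ∧ Bad l0 v := by
  classical
  obtain ⟨d, hd⟩ : ∃ d, theta K n j (MvPolynomial.homogeneousComponent d f) ≠ 0 := by
    by_contra hcon
    push Not at hcon
    apply hf
    rw [← MvPolynomial.sum_homogeneousComponent f, map_sum]
    exact Finset.sum_eq_zero fun i _ => hcon i
  set fd := MvPolynomial.homogeneousComponent d f with hfd
  have hh : fd.IsHomogeneous d := MvPolynomial.homogeneousComponent_isHomogeneous d f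
  have hnot : ¬ secant j (segreVariety K s n) ⊆ zeroLocus ({fd} : Set (MvPolynomial (Idx n) K)) := by
    intro hsub
    apply hd
    apply VI_theta d0 hj
    intro x hx v hv
    exact hsub hx fd rfl v hv
  obtain ⟨x, hx, hxu⟩ : ∃ x ∈ secant j (segreVariety K s n) \
      zeroLocus ({fd} : Set (MvPolynomial (Idx n) K)),
      ¬ ∃! S : Finset (PP K (Idx n)), S ∈ decompositions (segreVariety K s n) x := by
    by_contra hcon
    push Not at hcon
    exact hni ⟨_, isZClosed_zeroLocus hh, hnot, hcon⟩
  have hrep : x.rep ∈ x.submodule := by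
    rw [Projectivization.submodule_eq]
    exact Submodule.mem_span_singleton_self _
  have he : MvPolynomial.eval x.rep fd ≠ 0 := fun h =>
    hx.2 (mem_zeroLocus_of_rep hh x x.rep hrep x.rep_nonzero h)
  obtain ⟨c, hc0, hc⟩ : ∃ c : K, c ≠ 0 ∧ MvPolynomial.eval (c • x.rep) f ≠ 0 := by
    by_contra hcon
    push Not at hcon
    exact he (homog_comp_zero x.rep hcon d)
  have hv0 : c • x.rep ≠ 0 := smul_ne_zero hc0 x.rep_nonzero
  refine ⟨c • x.rep, hc, fun g hg => theta_VI d0.1 hg x hx.1 _ (Submodule.smul_mem _ _ hrep), ?_⟩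
  apply bad_of_not_unique d0 l0 _ hv0
  have : Projectivization.mk K (c • x.rep) hv0 = x := by
    conv_rhs => rw [← x.mk_rep]
    rw [Projectivization.mk_eq_mk_iff']
    exact ⟨c, rfl⟩
  rw [this]
  exact hxu

end stepone

section steptwo
open Function
universe w
variable {s : ℕ} {n : Fin s → ℕ}
variable {K : Type w} [Field K]

lemma exists_ultra (j : ℕ) : ∃ U : Ultrafilter {f : MvPolynomial (Idx n) K // theta K n j f ≠ 0},
    ∀ f : MvPolynomial (Idx n) K, theta K n j f ≠ 0 → ∀ᶠ g in (U : Filter {f : MvPolynomial (Idx n) K // theta K n j f ≠ 0}),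
      f ∣ g.1 := by
  classical
  let J := {f : MvPolynomial (Idx n) K // theta K n j f ≠ 0}
  obtain ⟨U, hU⟩ := Ultrafilter.exists_ultrafilter_of_finite_inter_nonempty
    (Set.range fun f : J => {g : J | f.1 ∣ g.1}) (by
      intro T hT
      choose h hh using fun x : T => hT x.2
      refine ⟨⟨∏ x, (h x).1, ?_⟩, ?_⟩
      · rw [map_prod]
        exact Finset.prod_ne_zero_iff.2 fun x _ => (h x).2
      · rintro S hS
        have := hh ⟨S, hS⟩
        simp only at this
        rw [← this]
        exact Finset.dvd_prod_of_mem (fun x => (h x).1) (Finset.mem_univ (⟨S, hS⟩ : T)))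
  exact ⟨U, fun f hf => hU ⟨⟨f, hf⟩, rfl⟩⟩

lemma ug_vec_eq_iff {J : Type*} (U : Ultrafilter J) (a b : J → Idx n → K) :
    ((fun t => ug U (fun g => a g t)) = fun t => ug U (fun g => b g t)) ↔
      ∀ᶠ g in (U : Filter J), a g = b g := by
  constructor
  · intro h
    have h1 : ∀ t, ∀ᶠ g in (U : Filter J), a g t = b g t := fun t =>
      (ug_eq_iff U _ _).1 (congrFun h t)
    filter_upwards [Filter.eventually_all.2 h1] with g hg
    exact funext hg
  · intro h
    funext t
    rw [ug_eq_iff]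
    filter_upwards [h] with g hg
    rw [hg]

lemma ug_sum {J : Type*} (U : Ultrafilter J) {j : ℕ} (u : J → Fin j → ∀ i, Fin (n i + 1) → K) :
    (fun t => ug U (fun g => (∑ l, rk1 (u g l)) t)) =
      ∑ l, rk1 (fun i x => ug U (fun g => u g l i x)) := by
  funext t
  rw [← sum_rk1_map (ug U) (fun l i x => fun g => u g l i x) t]
  congr 1
  funext g
  exact (sum_rk1_map (Pi.evalRingHom (fun _ : J => K) g) (fun l i x => fun g => u g l i x) t).symm

lemma ug_rk1 {J : Type*} (U : Ultrafilter J) (u : J → ∀ i, Fin (n i + 1) → K) :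
    (fun t => ug U (fun g => rk1 (u g) t)) =
      rk1 (fun i x => ug U (fun g => u g i x)) := by
  have := ug_sum U (j := 1) (fun g _ => u g)
  simpa using this

lemma step_two [IsAlgClosed K] [CharZero K] (i0 : Fin s) {j : ℕ} (l0 : Fin j) (hN : 0 < ∑ i, n i)
    {A : Type*} [Field A] [Algebra K A] (z : Fin j → Option (Dlt n) → A)
    (hgz : Gen K (Phi z) (Fintype.card (Fin j) * (∑ i, n i + 1)))
    (hker : ∀ f, MvPolynomial.aeval (Phi z) f = 0 ↔ theta K n j f = 0)
    (hW : ∀ (B : Type w) [Field B] [Algebra K B] (x : Fin j → Option (Dlt n) → B),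
      AlgebraicIndependent K (zf x) → ∀ l w, InW (ch x) l w → w = 0)
    (hbad : ∀ f, theta K n j f ≠ 0 → ∃ v : Idx n → K, MvPolynomial.eval v f ≠ 0 ∧
      (∀ g, theta K n j g = 0 → MvPolynomial.eval v g = 0) ∧ Bad l0 v) : False := by
  classical
  obtain ⟨U, hU⟩ := exists_ultra (n := n) (K := K) j
  choose v hv1 hv2 hv3 using fun f : {f : MvPolynomial (Idx n) K // theta K n j f ≠ 0} => hbad f.1 f.2
  letI := ugAlg U (K := K)
  haveI := ug_closed U (K := K)
  let q : Idx n → UG U K := fun t => ug U (fun g => v g t)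
  have hq : ∀ f : MvPolynomial (Idx n) K, MvPolynomial.aeval q f = 0 ↔ theta K n j f = 0 := by
    intro f
    rw [ug_aeval U v f, ← map_zero (ug U), ug_eq_iff]
    constructor
    · intro h
      by_contra hf
      obtain ⟨g, hg1, hg2⟩ := (h.and (hU f hf)).exists
      obtain ⟨a, ha⟩ := hg2
      apply hv1 g
      rw [ha, map_mul, hg1, Pi.zero_apply, zero_mul]
    · intro h
      exact Filter.Eventually.of_forall fun g => hv2 g f h
  have hqz : ∀ f, MvPolynomial.aeval q f = 0 ↔ MvPolynomial.aeval (Phi z) f = 0 := fun f =>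
    (hq f).trans (hker f).symm
  have hgq : Gen K q (Fintype.card (Fin j) * (∑ i, n i + 1)) :=
    gen_transfer (Phi z) q (fun f hf => (hqz f).1 hf) _ hgz
  obtain ⟨y, hy⟩ := exists_lift_Phi z q hqz (Phi_gen z hgz).2
  have hev : ∀ᶠ g in U.toFilter, ∃ u : Fin j → ∀ i, Fin (n i + 1) → K, v g = ∑ l, rk1 (u l) := by
    have h1 : ∀ l, ∃ u' : ∀ i, Fin (n i + 1) → UG U K, rk1 u' = y l none • GG (ch y l) none := by
      intro l
      rw [GG_none]
      exact exists_smul_rk1 i0 _ _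
    choose u' hu' using h1
    choose u hu using fun (l : Fin j) (i : Fin s) (x : Fin (n i + 1)) => ug_surj U (u' l i x)
    have h2 : q = fun t => ug U (fun g => (∑ l, rk1 (fun i x => u l i x g)) t) := by
      rw [ug_sum U (fun g l i x => u l i x g), hy]
      simp only [Phi, hu, ← hu']
    filter_upwards [(ug_vec_eq_iff U _ _).1 h2] with g hg
    exact ⟨_, hg⟩
  have hPQ : ∀ g, ∃ P Q : Fin j → ∀ i, Fin (n i + 1) → K,
      (∃ u : Fin j → ∀ i, Fin (n i + 1) → K, v g = ∑ l, rk1 (u l)) →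
      v g = ∑ l, rk1 (P l) ∧ v g = ∑ l, rk1 (Q l) ∧ ¬ Good P Q l0 := by
    intro g
    by_cases h : ∃ u : Fin j → ∀ i, Fin (n i + 1) → K, v g = ∑ l, rk1 (u l)
    · obtain ⟨P, Q, hh⟩ := hv3 g h
      exact ⟨P, Q, fun _ => hh⟩
    · exact ⟨fun _ _ _ => 0, fun _ _ _ => 0, fun h' => absurd h' h⟩
  choose P Q hPQ using hPQ
  let P' : Fin j → ∀ i, Fin (n i + 1) → UG U K := fun l i x => ug U (fun g => P g l i x)
  let Q' : Fin j → ∀ i, Fin (n i + 1) → UG U K := fun l i x => ug U (fun g => Q g l i x)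
  have hqP : q = ∑ l, rk1 (P' l) := by
    rw [← ug_sum U P]
    refine (ug_vec_eq_iff U _ _).2 ?_
    filter_upwards [hev] with g hg
    exact (hPQ g hg).1
  have hqQ : q = ∑ l, rk1 (Q' l) := by
    rw [← ug_sum U Q]
    refine (ug_vec_eq_iff U _ _).2 ?_
    filter_upwards [hev] with g hg
    exact (hPQ g hg).2.1
  obtain ⟨p, hp⟩ := exists_chart (K := K) P' (by rw [← hqP]; exact hgq)
  obtain ⟨x, hx⟩ := exists_chart (K := K) Q' (by rw [← hqQ]; exact hgq)
  have hpq : Phi p = q := by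
    rw [hqP, Phi]
    exact Finset.sum_congr rfl fun l _ => (hp l).symm
  have hxq : Phi x = q := by
    rw [hqQ, Phi]
    exact Finset.sum_congr rfl fun l _ => (hx l).symm
  obtain ⟨hp0, l, c, hc⟩ := uniqueness (K := K) p x (hpq.trans hxq.symm) hN (by rw [hpq]; exact hgq)
    (hW _ x (Phi_gen (K := K) x (by rw [hxq]; exact hgq)).1) l0
  have hP0 : rk1 (P' l0) ≠ 0 := by
    rw [hp]
    exact smul_ne_zero hp0 (GG_none_ne_zero _)
  have hPc : rk1 (P' l0) = (p l0 none * c) • rk1 (Q' l) := by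
    rw [hp, hx, hc, smul_smul]
  obtain ⟨c', hc'⟩ := ug_surj U (p l0 none * c)
  have hA : ∀ᶠ g in U.toFilter, rk1 (P g l0) = c' g • rk1 (Q g l) := by
    rw [← ug_vec_eq_iff]
    rw [ug_rk1 U (fun g => P g l0)]
    refine hPc.trans ?_
    rw [← hc']
    funext t
    have h3 := congrFun (ug_rk1 U (fun g => Q g l)) t
    rw [Pi.smul_apply, smul_eq_mul]
    change ug U c' * rk1 (fun i x => ug U (fun g => Q g l i x)) t = _
    rw [← h3, ← map_mul]
    rfl
  have hB : ∀ᶠ g in U.toFilter, rk1 (P g l0) ≠ 0 := by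
    refine Ultrafilter.eventually_not.2 ?_
    intro h
    apply hP0
    have h4 := (ug_vec_eq_iff U (fun g => rk1 (P g l0)) (fun _ => 0)).2 h
    rw [ug_rk1 U (fun g => P g l0)] at h4
    refine h4.trans ?_
    funext t
    exact map_zero (ug U)
  obtain ⟨g, hg1, hg2, hg3⟩ := (hA.and (hB.and hev)).exists
  exact (hPQ g hg3).2.2 ⟨hg2, l, c' g, hg1⟩

end steptwo

section final
open Function

lemma final_aux' {K : Type*} [Field K] [IsAlgClosed K] [CharZero K] [Infinite K] {q : ℕ} {n : Fin q → ℕ}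
    (d0 : Dlt n) (hs : ∀ d : Dlt n, ∃ e : Dlt n, d.1 ≠ e.1) (hNpos : 0 < ∑ i, n i) (m j : ℕ) (hm1 : 1 ≤ m)
    (hj : 1 ≤ j) (hjm : j ≤ m)
    {A : Type*} [Field A] [Algebra K A] (uv : Fin m → ∀ i, Fin (n i + 1) → A)
    (huv : AlgebraicIndependent K (fun p : Par n m => uv p.1 p.2.1 p.2.2))
    (hgm : Gen K (∑ l, rk1 (uv l)) (m * (∑ i, n i + 1)))
    (hcard : Fintype.card (Fin m) * (∑ i, n i + 1) < Fintype.card (Idx n))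
    (hLM : Fintype.card (Fin j) + ∑ i, n i ≤ Fintype.card (Fin m) + 1)
    (hni : ¬ Identifiable (segreVariety K q n) j) : False := by
  obtain ⟨z, hz⟩ := exists_chart (K := K) (uv) (by rw [Fintype.card_fin]; exact hgm)
  have hPz : Phi z = ∑ l, rk1 (uv l) := by
    rw [Phi]
    exact Finset.sum_congr rfl fun l _ => (hz l).symm
  obtain ⟨hzi, hza⟩ := Phi_gen (K := K) z (by rw [hPz, Fintype.card_fin]; exact hgm)
  have hzL := GF_linearIndependent z hzi hza
  have hafl : AlgebraicIndependent K (afl (ch z)) :=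
    hzi.comp (fun x : Fin m × Dlt n => (x.1, some x.2)) (by
      rintro ⟨a, b⟩ ⟨a', b'⟩ h
      simpa using h)
  have hinj : Injective (fun x : Fin j × Option (Dlt n) => (Fin.castLE hjm x.1, x.2)) := by
    rintro ⟨a, b⟩ ⟨a', b'⟩ h
    simpa using h
  obtain ⟨zj, hzjd⟩ : ∃ zj : Fin j → Option (Dlt n) → A, zj = fun l => z (Fin.castLE hjm l) :=
    ⟨_, rfl⟩
  have hzj : AlgebraicIndependent K (zf zj) := by
    rw [hzjd]; exact hzi.comp (fun x : Fin j × Option (Dlt n) => (Fin.castLE hjm x.1, x.2)) hinj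
  have hzjL : LinearIndependent (A) (GF (ch zj)) := by
    rw [hzjd]; exact hzL.comp (fun x : Fin j × Option (Dlt n) => (Fin.castLE hjm x.1, x.2)) hinj
  have hgj := gen_of_LI zj hzj hzjL
  have hPj : Phi zj = ∑ l : Fin j, rk1 (uv (Fin.castLE hjm l)) := by
    rw [hzjd, Phi]
    exact Finset.sum_congr rfl fun l _ => (hz _).symm
  have hker : ∀ f, MvPolynomial.aeval (Phi zj) f = 0 ↔ theta K n j f = 0 := by
    intro f
    rw [hPj, ← theta_aeval (fun l => uv (Fin.castLE hjm l)) f]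
    have hi : AlgebraicIndependent K
        (fun p : Par n j => uv (Fin.castLE hjm p.1) p.2.1 p.2.2) :=
      huv.comp (fun p : Par n j => ((Fin.castLE hjm p.1, p.2) : Par n m)) (by
        rintro ⟨a, b⟩ ⟨a', b'⟩ h
        simpa using h)
    exact map_eq_zero_iff _ hi
  refine step_two d0.1 (⟨0, hj⟩ : Fin j) hNpos zj hgj hker ?_ (step_one d0 hj _ hni)
  intro B _ _ x hx l w hw
  exact Wzero (ch z) hafl hzL hs hcard hLM hNpos (ch x)
    (hx.comp (fun x : Fin j × Dlt n => (x.1, some x.2)) (by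
      rintro ⟨a, b⟩ ⟨a', b'⟩ h
      simpa using h)) l w hw

lemma final_aux {K : Type*} [Field K] [IsAlgClosed K] [CharZero K] [Infinite K] {q : ℕ} {n : Fin q → ℕ}
    (d0 : Dlt n) (hs : ∀ d : Dlt n, ∃ e : Dlt n, d.1 ≠ e.1) (hNpos : 0 < ∑ i, n i) (m j : ℕ) (hm1 : 1 ≤ m)
    (hj : 1 ≤ j) (hjm : j ≤ m)
    (hsec : zdim (secant m (segreVariety K q n)) =
      (((m * (∑ i, n i + 1) - 1 : ℕ) : ℕ∞) : WithBot ℕ∞))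
    (hcard : Fintype.card (Fin m) * (∑ i, n i + 1) < Fintype.card (Idx n))
    (hLM : Fintype.card (Fin j) + ∑ i, n i ≤ Fintype.card (Fin m) + 1)
    (hni : ¬ Identifiable (segreVariety K q n) j) : False :=
  final_aux' d0 hs hNpos m j hm1 hj hjm (uh K n m) (uh_indep m) (gen_of_dim d0 m hm1 hsec) hcard hLM hni

end final

/-- **Theorem (ipx).**  Let `X ⊆ ℙ^r` be the Segre embedding of
`ℙ^{n 1} × ⋯ × ℙ^{n q}` (char `0`), with `N = ∑ n i = dim X` and
`r = -1 + ∏ (n i + 1)`.  Let `k` be a positive integer and assume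
`dim σ_{k+N-1}(X) = (k+N-1)(N+1) - 1 < r`.  Then `X` is `j`-identifiable for every
`j ≤ k`. -/
theorem statement15 {K : Type*} [Field K] [IsAlgClosed K] [CharZero K]
    (q : ℕ) (n : Fin q → ℕ) (hn : ∀ i, 0 < n i)
    (N r k : ℕ) (hN : N = ∑ i, n i) (hr : r + 1 = ∏ i, (n i + 1))
    (hk : 1 ≤ k)
    (hsec : zdim (secant (k + N - 1) (segreVariety K q n)) =
      ((((k + N - 1) * (N + 1) - 1 : ℕ) : ℕ∞) : WithBot ℕ∞))
    (hlt : (k + N - 1) * (N + 1) - 1 < r) :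
    ∀ j : ℕ, 1 ≤ j → j ≤ k → Identifiable (segreVariety K q n) j := by
  intro j hj hjk
  by_contra hni
  haveI : Infinite K := IsAlgClosed.instInfinite
  subst hN
  have hq0 : q ≠ 0 := by
    rintro rfl
    simp at hr
    omega
  have hq1 : q ≠ 1 := by
    rintro rfl
    simp at hr hlt
    have h1 := hn 0
    have h2 : n 0 * (n 0 + 1) ≤ (k + n 0 - 1) * (n 0 + 1) := Nat.mul_le_mul_right _ (by omega)
    have h3 : n 0 + 1 ≤ n 0 * (n 0 + 1) := Nat.le_mul_of_pos_left _ h1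
    omega
  let i0 : Fin q := ⟨0, by omega⟩
  let i1 : Fin q := ⟨1, by omega⟩
  have h01 : i0 ≠ i1 := by
    intro h
    have := congrArg Fin.val h
    simp [i0, i1] at this
  let d0 : Dlt n := ⟨i0, ⟨0, hn i0⟩⟩
  let d1 : Dlt n := ⟨i1, ⟨0, hn i1⟩⟩
  have hs : ∀ d : Dlt n, ∃ e : Dlt n, d.1 ≠ e.1 := by
    intro d
    by_cases h : d.1 = i0
    · exact ⟨d1, by rw [h]; exact h01⟩
    · exact ⟨d0, h⟩
  have hNpos : 0 < ∑ i, n i := Finset.sum_pos (fun i _ => hn i) ⟨i0, Finset.mem_univ _⟩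
  obtain ⟨m, hm⟩ : ∃ m, m = k + ∑ i, n i - 1 := ⟨_, rfl⟩
  rw [← hm] at hsec hlt
  have hm1 : 1 ≤ m := by omega
  have hcard : Fintype.card (Fin m) * (∑ i, n i + 1) < Fintype.card (Idx n) := by
    rw [card_Idx, ← hr, Fintype.card_fin]
    omega
  have hLM : Fintype.card (Fin j) + ∑ i, n i ≤ Fintype.card (Fin m) + 1 := by
    rw [Fintype.card_fin, Fintype.card_fin]; omega
  have hjm : j ≤ m := by omega
  exact final_aux d0 hs hNpos m j hm1 hj hjm hsec hcard hLM hni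


end ContactLoci
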